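/- arXiv:1306.5316 — 3 statements merged into one kernel-verified Lean document; each statement's English description precedes it below -/
import Mathlib

section
/- If G is a graph on n vertices and C' is an Ore-cycle of G, then G contains a (genuine) cycle C with V(C') ⊆ V(C). -/
open SimpleGraph

/-- A vertex is heavy if its degree is at least half the number of vertices. -/
def Heavy {V : Type*} [Fintype V] (G : SimpleGraph V) (v : V) : Prop :=
  Fintype.card V ≤ 2 * (G.neighborSet v).ncard

/-- `{x,y} ∈ Ẽ(G)`: distinct vertices that are adjacent or have degree sum at least `n`. -/
def TEdge {V : Type*} [Fintype V] (G : SimpleGraph V) (x y : V) : Prop :=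
  x ≠ y ∧ (G.Adj x y ∨
    Fintype.card V ≤ (G.neighborSet x).ncard + (G.neighborSet y).ncard)

/-- `a` is the center and `b,c,d` the end vertices of an induced claw `K_{1,3}`. -/
def IsClaw {V : Type*} (G : SimpleGraph V) (a b c d : V) : Prop :=
  G.Adj a b ∧ G.Adj a c ∧ G.Adj a d ∧
    ¬ G.Adj b c ∧ ¬ G.Adj b d ∧ ¬ G.Adj c d ∧ b ≠ c ∧ b ≠ d ∧ c ≠ d

/-- Every claw has at least one heavy end vertex. -/
def OneHeavy {V : Type*} [Fintype V] (G : SimpleGraph V) : Prop :=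
  ∀ a b c d, IsClaw G a b c d → Heavy G b ∨ Heavy G c ∨ Heavy G d

/-- Every claw has at least two heavy end vertices. -/
def TwoHeavy {V : Type*} [Fintype V] (G : SimpleGraph V) : Prop :=
  ∀ a b c d, IsClaw G a b c d →
    (Heavy G b ∧ Heavy G c) ∨ (Heavy G b ∧ Heavy G d) ∨ (Heavy G c ∧ Heavy G d)

/-- Every claw has two end vertices with degree sum at least `n`. -/
def ClawHeavy {V : Type*} [Fintype V] (G : SimpleGraph V) : Prop :=
  ∀ a b c d, IsClaw G a b c d →
    Fintype.card V ≤ (G.neighborSet b).ncard + (G.neighborSet c).ncard ∨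
    Fintype.card V ≤ (G.neighborSet b).ncard + (G.neighborSet d).ncard ∨
    Fintype.card V ≤ (G.neighborSet c).ncard + (G.neighborSet d).ncard

/-- `G` contains no induced claw. -/
def ClawFree {V : Type*} (G : SimpleGraph V) : Prop :=
  ∀ a b c d, ¬ IsClaw G a b c d

/-- Almost distance-hereditary: in every connected induced subgraph the distance
between two vertices exceeds their distance in `G` by at most one. -/
def AlmostDH {V : Type*} (G : SimpleGraph V) : Prop :=
  ∀ s : Set V, (G.induce s).Connected →
    ∀ x y : s, (G.induce s).dist x y ≤ G.dist (x : V) (y : V) + 1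

/-- Distance-hereditary: every connected induced subgraph preserves distances. -/
def DistHered {V : Type*} (G : SimpleGraph V) : Prop :=
  ∀ s : Set V, (G.induce s).Connected →
    ∀ x y : s, (G.induce s).dist x y = G.dist (x : V) (y : V)

/-- A cycle in `G`, encoded as an injective cyclic sequence of `m ≥ 3` pairwise
adjacent-in-order vertices. -/
def IsCycleMap {V : Type*} (G : SimpleGraph V) (m : ℕ) (f : ZMod m → V) : Prop :=
  3 ≤ m ∧ Function.Injective f ∧ ∀ i, G.Adj (f i) (f (i + 1))

/-- A longest cycle of `G`. -/
def IsLongestCycleMap {V : Type*} (G : SimpleGraph V) (m : ℕ) (f : ZMod m → V) : Prop :=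
  IsCycleMap G m f ∧ ∀ (m' : ℕ) (f' : ZMod m' → V), IsCycleMap G m' f' → m' ≤ m

/-- `R` is a connected component of the subgraph of `G` induced on `W`. -/
def IsCompOf {V : Type*} (G : SimpleGraph V) (W R : Set V) : Prop :=
  R.Nonempty ∧ R ⊆ W ∧ (G.induce R).Connected ∧
    ∀ x ∈ R, ∀ y ∈ W, G.Adj x y → y ∈ R

/-- A closed list gives a cycle map with the same vertex set. -/
theorem cycleMap_of_list {V : Type*} (G : SimpleGraph V) (l : List V) (hl : l.Nodup)
    (h3 : 3 ≤ l.length) (hc : l.IsChain G.Adj) (hne : l ≠ [])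
    (hlast : G.Adj (l.getLast hne) (l.head hne)) :
    ∃ (m : ℕ) (f : ZMod m → V), IsCycleMap G m f ∧ ∀ z ∈ l, z ∈ Set.range f := by
  obtain ⟨n, hn⟩ : ∃ n, l.length = n + 1 := ⟨l.length - 1, by omega⟩
  let f : Fin (n + 1) → V := fun i => l[i.val]'(by omega)
  have hadj : ∀ i : Fin (n + 1), G.Adj (f i) (f (i + 1)) := by
    intro i
    have hlt : (i + 1 : Fin (n + 1)).val < l.length := by
      rw [hn]; exact (i + 1 : Fin (n + 1)).isLt
    change G.Adj (l[i.val]'(by omega)) (l[(i + 1 : Fin (n + 1)).val]'hlt)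
    by_cases hi : i = Fin.last n
    · subst hi
      have hv : (Fin.last n + 1 : Fin (n + 1)).val = 0 := by simp
      simp only [hv, Fin.val_last]
      rw [List.getLast_eq_getElem, List.head_eq_getElem] at hlast
      simpa [hn] using hlast
    · have hv : (i + 1 : Fin (n + 1)).val = i.val + 1 := by
        rw [Fin.val_add_one, if_neg hi]
      simp only [hv]
      have hi' : i.val < n := Fin.val_lt_last hi
      exact List.isChain_iff_getElem.1 hc i.val (by omega)
  refine ⟨n + 1, f, ⟨by omega, ?_, ?_⟩, ?_⟩
  · intro i j hij
    have := (hl.getElem_inj_iff).1 hij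
    exact Fin.ext this
  · exact hadj
  · intro z hz
    obtain ⟨j, hj, rfl⟩ := List.getElem_of_mem hz
    exact ⟨(⟨j, by omega⟩ : Fin (n + 1)), rfl⟩

/-- Ore's exchange argument: a path whose end vertices have degree sum at least `n` has its
vertex set contained in that of a cycle. -/
theorem exchange {V : Type*} [Fintype V] (G : SimpleGraph V) (l : List V) (hl : l.Nodup)
    (h3 : 3 ≤ l.length) (hc : l.IsChain G.Adj) (hne : l ≠ [])
    (hd : Fintype.card V ≤
      (G.neighborSet (l.head hne)).ncard + (G.neighborSet (l.getLast hne)).ncard) :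
    ∃ (l' : List V) (hne' : l' ≠ []), l'.Nodup ∧ 3 ≤ l'.length ∧ l'.IsChain G.Adj ∧
      G.Adj (l'.getLast hne') (l'.head hne') ∧ ∀ z ∈ l, z ∈ l' := by
  classical
  set x := l.head hne with hx
  set y := l.getLast hne with hy
  have hσy : l.formPerm y = x := by
    obtain ⟨a, t, rfl⟩ := List.exists_cons_of_ne_nil hne
    exact List.formPerm_apply_getLast a t
  have key : ∃ z, G.Adj y z ∧ G.Adj x (l.formPerm z) := by
    by_contra hcon
    push Not at hcon
    have hdis : Disjoint (G.neighborSet x) (l.formPerm '' G.neighborSet y) := by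
      rw [Set.disjoint_left]
      rintro _ h1 ⟨z, hz, rfl⟩
      exact hcon z hz h1
    have hcard : (G.neighborSet x ∪ l.formPerm '' G.neighborSet y).ncard =
        (G.neighborSet x).ncard + (G.neighborSet y).ncard := by
      rw [Set.ncard_union_eq hdis (Set.toFinite _) (Set.toFinite _),
        Set.ncard_image_of_injective _ l.formPerm.injective]
    have hlt : (G.neighborSet x ∪ l.formPerm '' G.neighborSet y).ncard <
        (Set.univ : Set V).ncard := by
      apply Set.ncard_lt_ncard _ (Set.toFinite _)
      rw [Set.ssubset_univ_iff]
      intro h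
      have hxm : x ∈ G.neighborSet x ∪ l.formPerm '' G.neighborSet y := by
        rw [h]; trivial
      rcases hxm with h1 | ⟨z, hz, h1⟩
      · exact G.loopless.irrefl _ h1
      · rw [← hσy] at h1
        have := l.formPerm.injective h1
        subst this
        exact G.loopless.irrefl _ hz
    rw [Set.ncard_univ, Nat.card_eq_fintype_card] at hlt
    omega
  obtain ⟨z, hyz, hxz⟩ := key
  by_cases hz : z ∈ l
  · obtain ⟨j, hj, rfl⟩ := List.getElem_of_mem hz
    have hj1 : j + 1 < l.length := by
      by_contra hcon
      apply hyz.ne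
      rw [hy, List.getLast_eq_getElem]
      congr 1
      omega
    rw [List.formPerm_apply_lt_getElem l hl j hj1] at hxz
    have hA : l.take (j + 1) ≠ [] := by simp [hne]
    have hB : l.drop (j + 1) ≠ [] := by
      intro h; have := congrArg List.length h; simp at this; omega
    have hAlast : (l.take (j + 1)).getLast hA = l[j] := by
      rw [List.getLast_eq_getElem]
      simp only [List.getElem_take, List.length_take]
      congr 1
      omega
    have hAhead : (l.take (j + 1)).head hA = x := by
      rw [hx, List.head_eq_getElem, List.head_eq_getElem]; simp
    have hBhead : (l.drop (j + 1)).head hB = l[j + 1] := by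
      rw [List.head_eq_getElem]; simp
    have hBlast : (l.drop (j + 1)).getLast hB = y := by
      rw [hy]; simp [List.getLast_drop]
    have hBr : (l.drop (j + 1)).reverse ≠ [] := by simpa using hB
    have hperm : (l.take (j + 1) ++ (l.drop (j + 1)).reverse).Perm l := by
      have h := List.Perm.append_left (l.take (j + 1)) (List.reverse_perm (l.drop (j + 1)))
      rwa [List.take_append_drop] at h
    refine ⟨l.take (j + 1) ++ (l.drop (j + 1)).reverse, by simp [hA], ?_, ?_, ?_, ?_, ?_⟩
    · exact hperm.nodup_iff.2 hl
    · rw [hperm.length_eq]; exact h3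
    · rw [List.isChain_append]
      refine ⟨hc.take _, ?_, ?_⟩
      · rw [List.isChain_reverse]
        refine (hc.drop (j + 1)).imp ?_
        intro a b hab
        exact hab.symm
      · intro a ha b hb
        rw [List.getLast?_eq_some_getLast hA, hAlast] at ha
        rw [List.head?_reverse, List.getLast?_eq_some_getLast hB, hBlast] at hb
        simp at ha hb
        subst ha; subst hb
        exact hyz.symm
    · rw [List.getLast_append_of_ne_nil _ hBr, List.head_append_of_ne_nil hA, hAhead,
        List.getLast_reverse, hBhead]
      exact hxz.symm
    · intro w hw
      exact hperm.mem_iff.2 hw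
  · rw [List.formPerm_apply_of_notMem hz] at hxz
    refine ⟨z :: l, by simp, ?_, ?_, ?_, ?_, ?_⟩
    · exact List.nodup_cons.2 ⟨hz, hl⟩
    · simp; omega
    · rw [List.isChain_cons]
      refine ⟨?_, hc⟩
      intro a ha
      rw [List.head?_eq_some_head hne] at ha
      simp at ha
      subst ha
      exact hxz.symm
    · rw [List.getLast_cons hne]
      exact hyz
    · intro w hw
      exact List.mem_cons_of_mem _ hw

/-- Opening a cycle at one edge gives a path with that edge deleted. -/
theorem open_cycle {V : Type*} (G : SimpleGraph V) (m : ℕ) (f : ZMod m → V)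
    (hf : IsCycleMap G m f) (i : ZMod m) :
    ∃ (l : List V) (hne : l ≠ []), l.Nodup ∧ 3 ≤ l.length ∧
      l.IsChain (G.deleteEdges {s(f i, f (i + 1))}).Adj ∧
      l.head hne = f (i + 1) ∧ l.getLast hne = f i ∧ ∀ z ∈ Set.range f, z ∈ l := by
  obtain ⟨h3, hinj, hadj⟩ := hf
  have : NeZero m := ⟨by omega⟩
  have hcast : ∀ a b : ℕ, a < m → b < m → (a : ZMod m) = b → a = b := by
    intro a b ha hb hab
    have := congrArg ZMod.val hab
    rwa [ZMod.val_natCast_of_lt ha, ZMod.val_natCast_of_lt hb] at this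
  have hm0 : ((m - 1 : ℕ) : ZMod m) + 1 = 0 := by
    have : ((m - 1 + 1 : ℕ) : ZMod m) = 0 := by
      rw [Nat.sub_add_cancel (by omega)]; exact ZMod.natCast_self m
    simpa using this
  refine ⟨List.ofFn (fun j : Fin m => f (i + 1 + (j.val : ZMod m))), ?_, ?_, ?_, ?_, ?_, ?_, ?_⟩
  · intro h; have := congrArg List.length h; simp at this; omega
  · rw [List.nodup_ofFn]
    intro a b hab
    have := add_left_cancel (hinj hab)
    exact Fin.ext (hcast _ _ a.2 b.2 this)
  · simpa using h3
  · rw [List.isChain_iff_getElem]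
    intro j hj
    simp only [List.length_ofFn] at hj
    simp only [List.getElem_ofFn]
    rw [SimpleGraph.deleteEdges_adj]
    push_cast
    rw [← add_assoc]
    refine ⟨hadj _, ?_⟩
    rw [Set.mem_singleton_iff, Sym2.eq_iff]
    rintro (⟨h1, -⟩ | ⟨h1, h2⟩)
    · have h := hinj h1
      have h' : ((j + 1 : ℕ) : ZMod m) = ((0 : ℕ) : ZMod m) := by
        push_cast; linear_combination h
      have := hcast _ _ hj (by omega) h'
      omega
    · have h := hinj h1
      have h' := hinj h2
      have h'' : ((2 : ℕ) : ZMod m) = ((0 : ℕ) : ZMod m) := by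
        push_cast; linear_combination h' - h
      have := hcast _ _ (by omega) (by omega) h''
      omega
  · rw [List.head_eq_getElem]; simp
  · rw [List.getLast_eq_getElem]
    simp only [List.getElem_ofFn, List.length_ofFn]
    congr 1
    linear_combination hm0
  · rintro _ ⟨w, rfl⟩
    rw [List.mem_ofFn]
    refine ⟨⟨(w - (i + 1)).val, ZMod.val_lt _⟩, ?_⟩
    simp

/-- If `C'` is an Ore-cycle of `G`, then `G` has a genuine cycle `C` with
`V(C') ⊆ V(C)`. -/
theorem cycle_of_oreCycle {V : Type*} [Fintype V] (G : SimpleGraph V)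
    (k : ℕ) (hk : 3 ≤ k) (u : ZMod k → V) (hinj : Function.Injective u)
    (hore : ∀ i, TEdge G (u i) (u (i + 1))) :
    ∃ (m : ℕ) (f : ZMod m → V), IsCycleMap G m f ∧
      Set.range u ⊆ Set.range f := by
  classical
  let P : SimpleGraph V → Prop := fun H => G ≤ H ∧ (∀ a b, H.Adj a b → TEdge G a b) ∧
    ∃ (m : ℕ) (f : ZMod m → V), IsCycleMap H m f ∧ Set.range u ⊆ Set.range f
  have hsymm : ∀ a b, TEdge G a b → TEdge G b a := by
    rintro a b ⟨h1, h2⟩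
    refine ⟨h1.symm, h2.imp (fun h => h.symm) (fun h => by omega)⟩
  have hP : ∃ H, P H := by
    refine ⟨{ Adj := TEdge G, symm := ⟨hsymm⟩, loopless := ⟨fun a h => h.1 rfl⟩ }, ?_, ?_, ?_⟩
    · intro a b h
      exact ⟨h.ne, Or.inl h⟩
    · intro a b h
      exact h
    · exact ⟨k, u, ⟨hk, hinj, hore⟩, subset_rfl⟩
  obtain ⟨H, ⟨hGH, hT, m, f, hf, hr⟩, hmin⟩ :=
    (Set.toFinite {H | P H}).exists_minimal hP
  by_cases hall : ∀ i, G.Adj (f i) (f (i + 1))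
  · exact ⟨m, f, ⟨hf.1, hf.2.1, hall⟩, hr⟩
  exfalso
  push Not at hall
  obtain ⟨i, hi⟩ := hall
  obtain ⟨l, hne, hl, h3, hc, hhead, hlast, hmem⟩ := open_cycle H m f hf i
  set K := H.deleteEdges {s(f i, f (i + 1))} with hK
  have hKH : K ≤ H := SimpleGraph.deleteEdges_le _
  have hGK : G ≤ K := by
    intro a b hab
    rw [hK, SimpleGraph.deleteEdges_adj]
    refine ⟨hGH hab, ?_⟩
    rw [Set.mem_singleton_iff, Sym2.eq_iff]
    rintro (⟨rfl, rfl⟩ | ⟨rfl, rfl⟩)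
    · exact hi hab
    · exact hi hab.symm
  have hdeg : ∀ v, (G.neighborSet v).ncard ≤ (K.neighborSet v).ncard := fun v =>
    Set.ncard_le_ncard (fun w hw => hGK hw) (Set.toFinite _)
  have hsum := (hT _ _ (hf.2.2 i)).2.resolve_left hi
  obtain ⟨l', hne', hl', h3', hc', hadj', hsub⟩ := exchange K l hl h3 hc hne (by
    rw [hhead, hlast]
    have h1 := hdeg (f i)
    have h2 := hdeg (f (i + 1))
    omega)
  obtain ⟨m', f', hf', hr'⟩ := cycleMap_of_list K l' hl' h3' hc' hne' hadj'
  have hPK : P K := ⟨hGK, fun a b h => hT a b (hKH h), m', f', hf',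
    fun z hz => hr' z (hsub z (hmem z (hr hz)))⟩
  have hHK : H ≤ K := hmin hPK hKH
  have := hHK (hf.2.2 i)
  rw [hK, SimpleGraph.deleteEdges_adj] at this
  exact this.2 rfl
end

section
/- Every 2-connected, claw-heavy, almost distance-hereditary graph on at least 3 vertices is Hamiltonian. -/
open SimpleGraph

/-! ### Segments: chains with prescribed end vertices -/

/-- `L` is a nonempty chain for the relation `T` from `a` to `b`. -/
structure Seg {V : Type*} (T : V → V → Prop) (a b : V) (L : List V) : Prop where
  chain : L.IsChain T
  hd : L.head? = some a
  lst : L.getLast? = some b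

namespace Seg

variable {V : Type*} {T : V → V → Prop} {a b c d : V} {L M : List V}

theorem single (a : V) : Seg T a a [a] := ⟨by simp, rfl, rfl⟩

theorem ne_nil (h : Seg T a b L) : L ≠ [] := by
  rintro rfl; simpa using h.hd

theorem app (h : Seg T a b L) (hbc : T b c) (h' : Seg T c d M) : Seg T a d (L ++ M) := by
  refine ⟨?_, ?_, ?_⟩
  · refine List.isChain_append.2 ⟨h.chain, h'.chain, ?_⟩
    intro x hx y hy
    rw [h.lst] at hx; rw [h'.hd] at hy
    simp at hx hy; subst hx; subst hy; exact hbc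
  · rw [List.head?_append, h.hd]; rfl
  · rw [List.getLast?_append, h'.lst]; rfl

theorem consL (hab : T a b) (h : Seg T b c L) : Seg T a c (a :: L) := (single a).app hab h

theorem rev (hT : ∀ x y, T x y → T y x) (h : Seg T a b L) : Seg T b a L.reverse := by
  refine ⟨?_, ?_, ?_⟩
  · exact List.isChain_reverse.2 (h.chain.imp (fun x y hh => hT _ _ hh))
  · rw [List.head?_reverse, h.lst]
  · rw [List.getLast?_reverse, h.hd]

theorem mono {S : V → V → Prop} (hT : ∀ x y, T x y → S x y) (h : Seg T a b L) : Seg S a b L :=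
  ⟨h.chain.imp (fun x y hh => hT _ _ hh), h.hd, h.lst⟩

theorem exists_of (h : L.IsChain T) (hn : L ≠ []) : ∃ a b, Seg T a b L := by
  refine ⟨L.head hn, L.getLast hn, h, ?_, ?_⟩
  · exact List.head?_eq_some_head hn
  · exact List.getLast?_eq_some_getLast hn

theorem split (h : Seg T a d (L ++ M)) (hL : L ≠ []) (hM : M ≠ []) :
    ∃ b c, Seg T a b L ∧ T b c ∧ Seg T c d M := by
  obtain ⟨h1, h2, h3⟩ := h
  obtain ⟨p1, p2, p3⟩ := List.isChain_append.1 h1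
  obtain ⟨a', b, hs⟩ := exists_of p1 hL
  obtain ⟨c, d', ht⟩ := exists_of p2 hM
  rw [List.head?_append, hs.hd] at h2
  rw [List.getLast?_append, ht.lst] at h3
  simp at h2 h3; subst h2; subst h3
  exact ⟨b, c, hs, p3 b hs.lst c ht.hd, ht⟩

theorem cons_inv (h : Seg T a d (c :: M)) (hM : M ≠ []) :
    c = a ∧ ∃ b, T a b ∧ Seg T b d M := by
  obtain ⟨b, e, h1, h2, h3⟩ := split (L := [c]) (M := M) h (by simp) hM
  have e1 := h1.hd; have e2 := h1.lst
  simp at e1 e2; subst e1; subst e2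
  exact ⟨rfl, e, h2, h3⟩

theorem single_inv (h : Seg T a b [c]) : c = a ∧ c = b := by
  have e1 := h.hd; have e2 := h.lst
  simp at e1 e2; exact ⟨e1, e2⟩

theorem head_mem (h : Seg T a b L) : a ∈ L := List.mem_of_head? h.hd
theorem last_mem (h : Seg T a b L) : b ∈ L := List.mem_of_getLast? h.lst

theorem head_eq (h : Seg T a b (c :: L)) : a = c := by
  have := h.hd; simp at this; exact this.symm

theorem hd_unique {S : V → V → Prop} (h : Seg T a b L) (h' : Seg S c d L) : a = c := by
  have := h.hd.symm.trans h'.hd; simpa using this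

theorem lst_unique {S : V → V → Prop} (h : Seg T a b L) (h' : Seg S c d L) : b = d := by
  have := h.lst.symm.trans h'.lst; simpa using this

end Seg

section Basics

variable {V : Type*} [Fintype V] {G : SimpleGraph V}

/-- degree -/
noncomputable def dgr (G : SimpleGraph V) (x : V) : ℕ := (G.neighborSet x).ncard

/-- heavy pair -/
def HP (G : SimpleGraph V) (x y : V) : Prop := Fintype.card V ≤ dgr G x + dgr G y

theorem te_adj {x y : V} (h : G.Adj x y) : TEdge G x y := ⟨h.ne, Or.inl h⟩

theorem te_symm {x y : V} (h : TEdge G x y) : TEdge G y x := by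
  refine ⟨h.1.symm, h.2.imp (fun h => h.symm) (fun h => by omega)⟩

theorem te_cases {x y : V} (h : TEdge G x y) : G.Adj x y ∨ HP G x y := h.2

theorem te_hp {x y : V} (hne : x ≠ y) (h : HP G x y) : TEdge G x y := ⟨hne, Or.inr h⟩

theorem hp_symm {x y : V} (h : HP G x y) : HP G y x := by
  unfold HP at *; omega

theorem hp_thr {a b c d : V} (h1 : HP G a b) (h2 : HP G c d) : HP G a c ∨ HP G b d := by
  unfold HP at *; omega

theorem claw3 (hch : ClawHeavy G) {c a b d : V} (ha : G.Adj c a) (hb : G.Adj c b) (hd : G.Adj c d)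
    (hab : a ≠ b) (had : a ≠ d) (hbd : b ≠ d) :
    TEdge G a b ∨ TEdge G a d ∨ TEdge G b d := by
  by_cases h1 : G.Adj a b
  · exact Or.inl (te_adj h1)
  by_cases h2 : G.Adj a d
  · exact Or.inr (Or.inl (te_adj h2))
  by_cases h3 : G.Adj b d
  · exact Or.inr (Or.inr (te_adj h3))
  rcases hch c a b d ⟨ha, hb, hd, h1, h2, h3, hab, had, hbd⟩ with h | h | h
  · exact Or.inl ⟨hab, Or.inr h⟩
  · exact Or.inr (Or.inl ⟨had, Or.inr h⟩)
  · exact Or.inr (Or.inr ⟨hbd, Or.inr h⟩)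

abbrev TSeg (G : SimpleGraph V) (a b : V) (L : List V) : Prop := Seg (TEdge G) a b L
abbrev ESeg (G : SimpleGraph V) (a b : V) (L : List V) : Prop := Seg G.Adj a b L

theorem Seg.toT {a b : V} {L : List V} (h : ESeg G a b L) : TSeg G a b L :=
  h.mono (fun _ _ h => te_adj h)
theorem Seg.revT {a b : V} {L : List V} (h : TSeg G a b L) : TSeg G b a L.reverse :=
  h.rev (fun _ _ h => te_symm h)
theorem Seg.revE {a b : V} {L : List V} (h : ESeg G a b L) : ESeg G b a L.reverse :=
  h.rev (fun _ _ h => h.symm)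

end Basics

/-! ### Potential functions and almost distance-hereditary graphs -/

section ADH
variable {V : Type*} {G : SimpleGraph V}

theorem pot_le (s : Set V) (hc : (G.induce s).Connected) (f : V → ℕ)
    (hf : ∀ a ∈ s, ∀ b ∈ s, G.Adj a b → f b ≤ f a + 1) (a b : s) :
    f b ≤ f a + (G.induce s).dist a b := by
  obtain ⟨p, hp⟩ := hc.exists_walk_length_eq_dist a b
  rw [← hp]
  clear hp
  induction p with
  | nil => simp
  | cons h p ih =>
    have := hf _ (Subtype.prop _) _ (Subtype.prop _) h
    simp only [SimpleGraph.Walk.length_cons]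
    omega

theorem adh_pot (hadh : AlmostDH G) (s : Set V) (hc : (G.induce s).Connected) (f : V → ℕ)
    (hf : ∀ a ∈ s, ∀ b ∈ s, G.Adj a b → f b ≤ f a + 1) {a b w : V} (ha : a ∈ s) (hb : b ∈ s)
    (haw : G.Adj a w) (hbw : G.Adj w b) : f b ≤ f a + 3 := by
  have h1 := pot_le s hc f hf ⟨a, ha⟩ ⟨b, hb⟩
  have h2 := hadh s hc ⟨a, ha⟩ ⟨b, hb⟩
  have h3 : G.dist a b ≤ 2 :=
    SimpleGraph.dist_le (SimpleGraph.Walk.cons haw (SimpleGraph.Walk.cons hbw SimpleGraph.Walk.nil))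
  simp only at h1 h2
  omega

theorem seg_connected {a b : V} {L : List V} (h : Seg G.Adj a b L) :
    (G.induce {x | x ∈ L}).Connected := by
  induction L generalizing a with
  | nil => exact absurd rfl h.ne_nil
  | cons c M ih =>
    by_cases hM : M = []
    · subst hM
      have : {x | x ∈ [c]} = ({c} : Set V) := by ext; simp
      rw [this]; simp
    · obtain ⟨rfl, b', h1, h2⟩ := h.cons_inv hM
      have := ih h2
      have e : {x | x ∈ c :: M} = ({c, b'} : Set V) ∪ {x | x ∈ M} := by
        ext y; simp
        constructor
        · tauto
        · rintro ((h | h) | h)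
          · exact Or.inl h
          · subst h; exact Or.inr h2.head_mem
          · exact Or.inr h
      rw [e]
      refine SimpleGraph.induce_union_connected ?_ this.preconnected ⟨b', by simp, h2.head_mem⟩
      exact (SimpleGraph.induce_pair_connected_of_adj h1).preconnected

theorem adh_p5 (hadh : AlmostDH G) {a b c d e w : V} (hab : G.Adj a b) (hbc : G.Adj b c)
    (hcd : G.Adj c d) (hde : G.Adj d e) (hac : ¬ G.Adj a c) (had : ¬ G.Adj a d) (hae : ¬ G.Adj a e)
    (hbd : ¬ G.Adj b d) (hbe : ¬ G.Adj b e) (hce : ¬ G.Adj c e)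
    (haw : G.Adj a w) (hwe : G.Adj w e) : False := by
  classical
  have hs : Seg G.Adj a e [a, b, c, d, e] :=
    .consL hab (.consL hbc (.consL hcd (.consL hde (.single e))))
  have n1 := hab.ne
  have n2 := hbc.ne
  have n3 := hcd.ne
  have n4 := hde.ne
  have n5 : a ≠ c := by rintro rfl; exact had hcd
  have n6 : a ≠ d := by rintro rfl; exact hae hde
  have n7 : a ≠ e := by rintro rfl; exact had hde.symm
  have n8 : b ≠ d := by rintro rfl; exact hbe hde
  have n9 : b ≠ e := by rintro rfl; exact hbd hde.symm
  have n10 : c ≠ e := by rintro rfl; exact hbe hbc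
  let f : V → ℕ := fun x => if x = a then 0 else if x = b then 1 else if x = c then 2 else
    if x = d then 3 else 4
  have fa : f a = 0 := by simp [f]
  have fb : f b = 1 := by simp [f, n1.symm]
  have fc : f c = 2 := by simp [f, n5.symm, n2.symm]
  have fd : f d = 3 := by simp [f, n6.symm, n8.symm, n3.symm]
  have fe : f e = 4 := by simp [f, n7.symm, n9.symm, n10.symm, n4.symm]
  have := adh_pot hadh _ (seg_connected hs) f ?_ hs.head_mem hs.last_mem haw hwe
  · omega
  · intro x hx y hy hxy
    have hx' : x = a ∨ x = b ∨ x = c ∨ x = d ∨ x = e := by simpa using hx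
    have hy' : y = a ∨ y = b ∨ y = c ∨ y = d ∨ y = e := by simpa using hy
    rcases hx' with rfl | rfl | rfl | rfl | rfl <;> rcases hy' with rfl | rfl | rfl | rfl | rfl <;>
      first
        | omega
        | (exfalso; first | exact hac hxy | exact had hxy | exact hae hxy | exact hbd hxy |
            exact hbe hxy | exact hce hxy)
end ADH
/-! ### The configuration around two attachment vertices -/

section FrameSec

variable {V : Type*} [Fintype V] {G : SimpleGraph V}

/-- The cycle `u, Q1, v, Q2` with consequences of its maximality. -/
structure Frame (G : SimpleGraph V) (u v u1 v0 v1 u0 : V) (Q1 Q2 : List V) : Prop where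
  s1 : ESeg G u1 v0 Q1
  s2 : ESeg G v1 u0 Q2
  eu1 : G.Adj u u1
  ev0 : G.Adj v v0
  ev1 : G.Adj v v1
  eu0 : G.Adj u u0
  nd : (u :: Q1 ++ v :: Q2).Nodup
  hNo : ∀ L, TSeg G u v L → L.Perm (u :: Q1 ++ v :: Q2) → False
  fu1 : ∀ s ∈ Q1, ∀ s' ∈ Q1, G.Adj u s → G.Adj u s' → s ≠ s' → TEdge G s s'
  fu2 : ∀ s ∈ Q1, G.Adj u s → TEdge G s u0
  fv1 : ∀ s ∈ Q1, ∀ s' ∈ Q1, G.Adj v s → G.Adj v s' → s ≠ s' → TEdge G s s'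
  fv2 : ∀ s ∈ Q1, G.Adj v s → TEdge G s v1

namespace Frame

variable {u v u1 v0 v1 u0 : V} {Q1 Q2 : List V}

theorem mirror (F : Frame G u v u1 v0 v1 u0 Q1 Q2) :
    Frame G v u v0 u1 u0 v1 Q1.reverse Q2.reverse := by
  classical
  have hp : (v :: Q1.reverse ++ u :: Q2.reverse).Perm (u :: Q1 ++ v :: Q2) := by
    refine List.perm_iff_count.2 (fun a => ?_)
    simp only [List.count_append, List.count_cons, List.count_reverse]
    omega
  refine ⟨F.s1.revE, F.s2.revE, F.ev0, F.eu1, F.eu0, F.ev1, hp.nodup_iff.2 F.nd, ?_, ?_, ?_, ?_, ?_⟩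
  · intro L hL hLp
    exact F.hNo L.reverse hL.revT ((List.reverse_perm L).trans (hLp.trans hp))
  · intro s hs s' hs'; exact F.fv1 s (by simpa using hs) s' (by simpa using hs')
  · intro s hs; exact F.fv2 s (by simpa using hs)
  · intro s hs s' hs'; exact F.fu1 s (by simpa using hs) s' (by simpa using hs')
  · intro s hs; exact F.fu2 s (by simpa using hs)

theorem no_u_v1 (F : Frame G u v u1 v0 v1 u0 Q1 Q2) : ¬ TEdge G u v1 := by
  classical
  intro h
  have t := F.fu2 u1 F.s1.head_mem F.eu1
  have p := Seg.consL h (F.s2.toT.app (te_symm t) (F.s1.toT.app (te_adj F.ev0.symm) (.single v)))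
  refine F.hNo _ p (List.perm_iff_count.2 (fun a => ?_))
  simp only [List.count_append, List.count_cons, List.count_reverse, List.count_nil]
  omega

theorem no_u_v0 (F : Frame G u v u1 v0 v1 u0 Q1 Q2) : ¬ TEdge G u v0 := by
  classical
  intro h
  have t := F.fu2 u1 F.s1.head_mem F.eu1
  have p := Seg.consL h (F.s1.toT.revT.app t (F.s2.toT.revT.app (te_adj F.ev1.symm) (.single v)))
  refine F.hNo _ p (List.perm_iff_count.2 (fun a => ?_))
  simp only [List.count_append, List.count_cons, List.count_reverse, List.count_nil]
  omega

theorem no_u1_v1 (F : Frame G u v u1 v0 v1 u0 Q1 Q2) : ¬ TEdge G u1 v1 := by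
  classical
  intro h
  have p := Seg.consL (te_adj F.eu0) (F.s2.toT.revT.app (te_symm h)
    (F.s1.toT.app (te_adj F.ev0.symm) (.single v)))
  refine F.hNo _ p (List.perm_iff_count.2 (fun a => ?_))
  simp only [List.count_append, List.count_cons, List.count_reverse, List.count_nil]
  omega

theorem touch1 (F : Frame G u v u1 v0 v1 u0 Q1 Q2) {I J : List V} {i j : V}
    (hQ : Q1 = I ++ J) (hI : TSeg G u1 i I) (hJ : TSeg G j v0 J) (h1 : TEdge G u i)
    (h2 : TEdge G v j) : False := by
  classical
  have t := F.fu2 u1 F.s1.head_mem F.eu1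
  have t' := F.fv2 v0 F.s1.last_mem F.ev0
  have p := Seg.consL h1 (hI.revT.app t (F.s2.toT.revT.app (te_symm t')
    (hJ.revT.app (te_symm h2) (.single v))))
  refine F.hNo _ p (List.perm_iff_count.2 (fun a => ?_))
  subst hQ
  simp only [List.count_append, List.count_cons, List.count_reverse, List.count_nil]
  omega

theorem touch2 (F : Frame G u v u1 v0 v1 u0 Q1 Q2) {I J : List V} {i j : V}
    (hQ : Q1 = I ++ J) (hI : TSeg G u1 i I) (hJ : TSeg G j v0 J) (h1 : TEdge G u j)
    (h2 : TEdge G v i) : False := by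
  classical
  have t := F.fu2 u1 F.s1.head_mem F.eu1
  have t' := F.fv2 v0 F.s1.last_mem F.ev0
  have p := Seg.consL h1 (hJ.app t' (F.s2.toT.app (te_symm t)
    (hI.app (te_symm h2) (.single v))))
  refine F.hNo _ p (List.perm_iff_count.2 (fun a => ?_))
  subst hQ
  simp only [List.count_append, List.count_cons, List.count_reverse, List.count_nil]
  omega

/-- Lemma D: a neighbour of `u` in `Q1` is not `T`-related to `v`. -/
theorem lemD (F : Frame G u v u1 v0 v1 u0 Q1 Q2) (hch : ClawHeavy G) {s : V} (hs : s ∈ Q1)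
    (hus : G.Adj u s) : ¬ TEdge G v s := by
  classical
  intro hvs
  obtain ⟨I, K, hQ⟩ := List.append_of_mem hs
  have S1 := F.s1
  have nd := F.nd
  rw [hQ] at S1 nd
  by_cases hI : I = []
  · subst hI
    have e : u1 = s := S1.head_eq
    subst e
    exact F.mirror.no_u_v0 hvs
  by_cases hK : K = []
  · subst hK
    have e : v0 = s := by simpa using S1.lst.symm
    subst e
    exact F.no_u_v0 (te_adj hus)
  obtain ⟨i, s', hsI, his, hsK'⟩ := S1.split hI (by simp)
  obtain ⟨rfl, k, hsk, hsK⟩ := hsK'.cons_inv hK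
  have hiI := hsI.last_mem
  have hkK := hsK.head_mem
  have nui : ¬ TEdge G u i := fun h => F.touch1 hQ hsI.toT hsK'.toT h hvs
  have nuk : ¬ TEdge G u k := fun h =>
    F.touch2 (I := I ++ [s]) (J := K) (by simp [hQ])
      (hsI.toT.app (te_adj his) (.single s)) hsK.toT h hvs
  have hik : i ≠ k := by
    rintro rfl
    simp [List.nodup_append, List.nodup_cons] at nd
    grind
  have hui : u ≠ i := by
    rintro rfl
    simp [List.nodup_append, List.nodup_cons] at nd
    grind
  have huk : u ≠ k := by
    rintro rfl
    simp [List.nodup_append, List.nodup_cons] at nd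
    grind
  have tik : TEdge G i k := by
    rcases claw3 hch hus.symm his.symm hsk hui huk hik with h | h | h
    · exact absurd h nui
    · exact absurd h nuk
    · exact h
  have hsu1 : s ≠ u1 := by
    rintro rfl
    have := hsI.head_mem
    simp [List.nodup_append, List.nodup_cons] at nd
    grind
  have tsu1 := F.fu1 s hs u1 F.s1.head_mem hus F.eu1 hsu1
  have t' := F.fv2 v0 F.s1.last_mem F.ev0
  have p := Seg.consL (te_adj F.eu0) (F.s2.toT.revT.app (te_symm t')
    (hsK.toT.revT.app (te_symm tik) (hsI.toT.revT.app (te_symm tsu1)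
      (Seg.consL (te_symm hvs) (.single v)))))
  refine F.hNo _ p (List.perm_iff_count.2 (fun a => ?_))
  rw [hQ]
  simp only [List.count_append, List.count_cons, List.count_reverse, List.count_nil]
  omega

end Frame

end FrameSec
/-! ### A strand inside `Q1` -/

section StrandSec

variable {V : Type*} [Fintype V] {G : SimpleGraph V}

/-- An edge `q r` inside `Q1` with `u ~ q`, `r ~ v`, and a common neighbour `x` of `u`, `v`. -/
structure Strand (G : SimpleGraph V) (u v u1 v0 v1 u0 : V) (Q1 Q2 : List V)
    (I J K : List V) (q r q1 r0 x : V) : Prop where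
  F : Frame G u v u1 v0 v1 u0 Q1 Q2
  hQ : Q1 = I ++ q :: (J ++ r :: K)
  sJ : ESeg G q1 r0 J
  qq1 : G.Adj q q1
  rr0 : G.Adj r r0
  uq : G.Adj u q
  vr : G.Adj v r
  qr : G.Adj q r
  xu : G.Adj x u
  xv : G.Adj x v
  xQ : ∀ s ∈ Q1, ¬ G.Adj x s
  xu0 : ¬ G.Adj x u0
  xv1 : ¬ G.Adj x v1

/-- Rerouting of the initial piece `u, I` so that it ends next to `u0`. -/
def Alpha (G : SimpleGraph V) (u u0 : V) (I : List V) : Prop :=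
  ∃ A e, TSeg G u e A ∧ A.Perm (u :: I) ∧ TEdge G e u0

namespace Strand

variable {u v u1 v0 v1 u0 : V} {Q1 Q2 I J K : List V} {q r q1 r0 x : V}

theorem mirror (S : Strand G u v u1 v0 v1 u0 Q1 Q2 I J K q r q1 r0 x) :
    Strand G v u v0 u1 u0 v1 Q1.reverse Q2.reverse K.reverse J.reverse I.reverse r q r0 q1 x := by
  refine ⟨S.F.mirror, ?_, S.sJ.revE, S.rr0, S.qq1, S.vr, S.uq, S.qr.symm, S.xv, S.xu, ?_, S.xv1, S.xu0⟩
  · simp [S.hQ]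
  · intro s hs; exact S.xQ s (by simpa using hs)

theorem nd (S : Strand G u v u1 v0 v1 u0 Q1 Q2 I J K q r q1 r0 x) :
    (u :: (I ++ q :: (J ++ r :: K)) ++ v :: Q2).Nodup := by
  have := S.F.nd; rwa [S.hQ] at this

theorem q_mem (S : Strand G u v u1 v0 v1 u0 Q1 Q2 I J K q r q1 r0 x) : q ∈ Q1 := by
  rw [S.hQ]; simp

theorem r_mem (S : Strand G u v u1 v0 v1 u0 Q1 Q2 I J K q r q1 r0 x) : r ∈ Q1 := by
  rw [S.hQ]; simp

theorem K_seg (S : Strand G u v u1 v0 v1 u0 Q1 Q2 I J K q r q1 r0 x) (hK : K ≠ []) :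
    ∃ r1, G.Adj r r1 ∧ ESeg G r1 v0 K := by
  have h := S.F.s1
  rw [S.hQ, show I ++ q :: (J ++ r :: K) = (I ++ q :: J ++ [r]) ++ K by simp] at h
  obtain ⟨a, b, h1, h2, h3⟩ := h.split (by simp) hK
  have e : a = r := by have := h1.lst; rw [List.getLast?_append] at this; simpa using this.symm
  subst e
  exact ⟨b, h2, h3⟩

theorem rK_seg (S : Strand G u v u1 v0 v1 u0 Q1 Q2 I J K q r q1 r0 x) : ESeg G r v0 (r :: K) := by
  have h := S.F.s1
  rw [S.hQ, show I ++ q :: (J ++ r :: K) = (I ++ q :: J) ++ r :: K by simp] at h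
  obtain ⟨a, b, h1, h2, h3⟩ := h.split (by simp) (by simp)
  have e := h3.head_eq
  subst e
  exact h3

theorem I_seg (S : Strand G u v u1 v0 v1 u0 Q1 Q2 I J K q r q1 r0 x) (hI : I ≠ []) :
    ∃ q0, G.Adj q0 q ∧ ESeg G u1 q0 I := by
  have h := S.F.s1
  rw [S.hQ] at h
  obtain ⟨a, b, h1, h2, h3⟩ := h.split hI (by simp)
  have e := h3.head_eq
  subst e
  exact ⟨a, h2, h1⟩

theorem alpha_nil (S : Strand G u v u1 v0 v1 u0 Q1 Q2 I J K q r q1 r0 x) (hI : I = []) :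
    Alpha G u u0 I :=
  ⟨[u], u, .single u, by rw [hI], te_adj S.F.eu0⟩

theorem alpha_cons (S : Strand G u v u1 v0 v1 u0 Q1 Q2 I J K q r q1 r0 x) {q0 : V}
    (hI : ESeg G u1 q0 I) (h : TEdge G u q0) : Alpha G u u0 I :=
  ⟨u :: I.reverse, u1, .consL h hI.toT.revT, (List.reverse_perm I).cons u,
    S.F.fu2 u1 S.F.s1.head_mem S.F.eu1⟩

theorem v1v0 (S : Strand G u v u1 v0 v1 u0 Q1 Q2 I J K q r q1 r0 x) : TEdge G v1 v0 :=
  te_symm (S.F.fv2 v0 S.F.s1.last_mem S.F.ev0)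

theorem u0u1 (S : Strand G u v u1 v0 v1 u0 Q1 Q2 I J K q r q1 r0 x) : TEdge G u0 u1 :=
  te_symm (S.F.fu2 u1 S.F.s1.head_mem S.F.eu1)

theorem a1 (S : Strand G u v u1 v0 v1 u0 Q1 Q2 I J K q r q1 r0 x) (hA : Alpha G u u0 I) {r1 : V}
    (hK : ESeg G r1 v0 K) : ¬ TEdge G r0 r1 := by
  classical
  intro h
  obtain ⟨A, e, sA, pA, te⟩ := hA
  have p := sA.app te (S.F.s2.toT.revT.app S.v1v0 (hK.toT.revT.app (te_symm h)
    (S.sJ.toT.revT.app (te_adj S.qq1.symm) (.consL (te_adj S.qr) (.consL (te_adj S.vr.symm)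
      (.single v))))))
  refine S.F.hNo _ p (List.perm_iff_count.2 (fun a => ?_))
  have := pA.count_eq a
  rw [S.hQ]
  simp only [List.count_append, List.count_cons, List.count_reverse, List.count_nil] at this ⊢
  omega

theorem a2 (S : Strand G u v u1 v0 v1 u0 Q1 Q2 I J K q r q1 r0 x) (hA : Alpha G u u0 I) :
    ¬ TEdge G r0 v := by
  classical
  intro h
  obtain ⟨A, e, sA, pA, te⟩ := hA
  have p := sA.app te (S.F.s2.toT.revT.app S.v1v0 (S.rK_seg.toT.revT.app (te_adj S.qr.symm)
    (.consL (te_adj S.qq1) (S.sJ.toT.app h (.single v)))))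
  refine S.F.hNo _ p (List.perm_iff_count.2 (fun a => ?_))
  have := pA.count_eq a
  rw [S.hQ]
  simp only [List.count_append, List.count_cons, List.count_reverse, List.count_nil] at this ⊢
  omega

theorem a3 (S : Strand G u v u1 v0 v1 u0 Q1 Q2 I J K q r q1 r0 x) (hA : Alpha G u u0 I) {r1 : V}
    (hK : ESeg G r1 v0 K) : ¬ TEdge G q r1 := by
  classical
  intro h
  obtain ⟨A, e, sA, pA, te⟩ := hA
  have p := sA.app te (S.F.s2.toT.revT.app S.v1v0 (hK.toT.revT.app (te_symm h)
    (.consL (te_adj S.qq1) (S.sJ.toT.app (te_adj S.rr0.symm) (.consL (te_adj S.vr.symm)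
      (.single v))))))
  refine S.F.hNo _ p (List.perm_iff_count.2 (fun a => ?_))
  have := pA.count_eq a
  rw [S.hQ]
  simp only [List.count_append, List.count_cons, List.count_reverse, List.count_nil] at this ⊢
  omega

theorem alpha_T (S : Strand G u v u1 v0 v1 u0 Q1 Q2 I J K q r q1 r0 x) (hch : ClawHeavy G)
    (hA : Alpha G u u0 I) {r1 : V} (hr1 : G.Adj r r1) (hK : ESeg G r1 v0 K) : TEdge G v r1 := by
  have nd := S.nd
  have m1 := hK.head_mem
  have m2 := S.sJ.last_mem
  have n1 : r0 ≠ v := by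
    rintro rfl
    simp [List.nodup_append, List.nodup_cons] at nd
    grind
  have n2 : r0 ≠ r1 := by
    rintro rfl
    simp [List.nodup_append, List.nodup_cons] at nd
    grind
  have n3 : v ≠ r1 := by
    rintro rfl
    simp [List.nodup_append, List.nodup_cons] at nd
    grind
  rcases claw3 hch S.rr0 S.vr.symm hr1 n1 n2 n3 with h | h | h
  · exact absurd h (S.a2 hA)
  · exact absurd h (S.a1 hA hK)
  · exact h

theorem alpha_beta (S : Strand G u v u1 v0 v1 u0 Q1 Q2 I J K q r q1 r0 x) (hch : ClawHeavy G)
    (hA : Alpha G u u0 I) : Alpha G v v1 K.reverse := by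
  by_cases hK : K = []
  · exact S.mirror.alpha_nil (by simp [hK])
  · obtain ⟨r1, h1, h2⟩ := S.K_seg hK
    exact S.mirror.alpha_cons h2.revE (S.alpha_T hch hA h1 h2)

/-- consequences of `Alpha`, seen at the `v`-end -/
theorem hX (S : Strand G u v u1 v0 v1 u0 Q1 Q2 I J K q r q1 r0 x) (hch : ClawHeavy G)
    (hadh : AlmostDH G) (hA : Alpha G u u0 I) :
    (∃ r1, ESeg G r1 v0 K ∧ HP G v r1 ∧ ¬ TEdge G q r1 ∧ ¬ TEdge G u r1) ∨
      (K = [] ∧ HP G r v1 ∧ ¬ TEdge G v1 q) := by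
  classical
  have nvq : ¬ TEdge G v q := S.F.lemD hch S.q_mem S.uq
  by_cases hK : K = []
  · right
    have t : TEdge G r v1 := S.F.fv2 r S.r_mem S.vr
    have hn : ¬ TEdge G v1 q := by
      intro h
      obtain ⟨A, e, sA, pA, te⟩ := hA
      have p := sA.app te (S.F.s2.toT.revT.app h (.consL (te_adj S.qq1)
        (S.sJ.toT.app (te_adj S.rr0.symm) (.consL (te_adj S.vr.symm) (.single v)))))
      refine S.F.hNo _ p (List.perm_iff_count.2 (fun a => ?_))
      have := pA.count_eq a
      rw [S.hQ, hK]
      simp only [List.count_append, List.count_cons, List.count_reverse, List.count_nil] at this ⊢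
      omega
    refine ⟨hK, ?_, hn⟩
    rcases te_cases t with h | h
    · exfalso
      refine adh_p5 hadh S.xu S.uq S.qr h (S.xQ _ S.q_mem) (S.xQ _ S.r_mem) S.xv1 ?_ ?_ ?_ S.xv S.F.ev1
      · exact fun hh => S.F.mirror.lemD hch (by simpa using S.r_mem) S.vr (te_adj hh)
      · exact fun hh => S.F.no_u_v1 (te_adj hh)
      · exact fun hh => hn (te_adj hh.symm)
    · exact h
  · left
    obtain ⟨r1, h1, h2⟩ := S.K_seg hK
    have t := S.alpha_T hch hA h1 h2
    have m : r1 ∈ Q1 := by rw [S.hQ]; simp [h2.head_mem]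
    have nu : ¬ TEdge G u r1 := by
      intro h
      have e : Q1 = ((I ++ q :: J) ++ [r]) ++ K := by simp [S.hQ]
      have hs := S.F.s1
      rw [e] at hs
      obtain ⟨a, b, k1, k2, k3⟩ := hs.split (by simp) hK
      have ea : a = r := by have := k1.lst; rw [List.getLast?_append] at this; simpa using this.symm
      subst ea
      exact S.F.touch2 e k1.toT h2.toT h (te_adj S.vr)
    have nq := S.a3 hA h2
    refine ⟨r1, h2, ?_, nq, nu⟩
    rcases te_cases t with h | h
    · exfalso
      refine adh_p5 hadh S.xu S.uq S.qr h1 (S.xQ _ S.q_mem) (S.xQ _ S.r_mem) (S.xQ _ m) ?_ ?_ ?_ S.xv h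
      · exact fun hh => S.F.mirror.lemD hch (by simpa using S.r_mem) S.vr (te_adj hh)
      · exact fun hh => nu (te_adj hh)
      · exact fun hh => nq (te_adj hh)
    · exact h

theorem no_alpha (S : Strand G u v u1 v0 v1 u0 Q1 Q2 I J K q r q1 r0 x) (hch : ClawHeavy G)
    (hadh : AlmostDH G) (hA : Alpha G u u0 I) : False := by
  have hB := S.alpha_beta hch hA
  have nd := S.nd
  have m1 := S.F.s2.head_mem
  have m2 := S.F.s2.last_mem
  have X := S.hX hch hadh hA
  have Y := S.mirror.hX hch hadh hB
  rcases X with ⟨r1, sK, hr, nq, nu⟩ | ⟨hK, hr, nq⟩ <;>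
    rcases Y with ⟨q0, sI, hq, nr, nv⟩ | ⟨hI, hq, nr⟩
  · have m3 := sK.head_mem
    have m4 : q0 ∈ I := by simpa using sI.head_mem
    rcases hp_thr hq (hp_symm hr) with h | h
    · refine nu (te_hp ?_ h)
      rintro rfl
      simp [List.nodup_append, List.nodup_cons] at nd
      grind
    · refine nv (te_hp ?_ (hp_symm h))
      rintro rfl
      simp [List.nodup_append, List.nodup_cons] at nd
      grind
  · have m3 := sK.head_mem
    rcases hp_thr (hp_symm hq) hr with h | h
    · refine S.F.mirror.no_u_v1 (te_hp ?_ (hp_symm h))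
      rintro rfl
      simp [List.nodup_append, List.nodup_cons] at nd
      grind
    · refine nq (te_hp ?_ h)
      rintro rfl
      simp [List.nodup_append, List.nodup_cons] at nd
      grind
  · have m4 : q0 ∈ I := by simpa using sI.head_mem
    rcases hp_thr (hp_symm hr) hq with h | h
    · refine S.F.no_u_v1 (te_hp ?_ (hp_symm h))
      rintro rfl
      simp [List.nodup_append, List.nodup_cons] at nd
      grind
    · refine nr (te_hp ?_ h)
      rintro rfl
      simp [List.nodup_append, List.nodup_cons] at nd
      grind
  · rcases hp_thr hq (hp_symm hr) with h | h
    · refine nq (te_hp ?_ (hp_symm h))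
      rintro rfl
      simp [List.nodup_append, List.nodup_cons] at nd
      grind
    · refine nr (te_hp ?_ h)
      rintro rfl
      simp [List.nodup_append, List.nodup_cons] at nd
      grind

theorem contra (S : Strand G u v u1 v0 v1 u0 Q1 Q2 I J K q r q1 r0 x) (hch : ClawHeavy G)
    (hadh : AlmostDH G) : False := by
  classical
  have nA : ¬ Alpha G u u0 I := fun h => S.no_alpha hch hadh h
  have nB : ¬ Alpha G v v1 K.reverse := fun h => S.mirror.no_alpha hch hadh h
  have hI : I ≠ [] := fun h => nA (S.alpha_nil h)
  have hK : K ≠ [] := fun h => nB (S.mirror.alpha_nil (by simp [h]))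
  obtain ⟨q0, hq0, sI⟩ := S.I_seg hI
  obtain ⟨r1, hr1, sK⟩ := S.K_seg hK
  have nuq0 : ¬ TEdge G u q0 := fun h => nA (S.alpha_cons sI h)
  have nvr1 : ¬ TEdge G v r1 := fun h => nB (S.mirror.alpha_cons sK.revE h)
  have nvq : ¬ TEdge G v q := S.F.lemD hch S.q_mem S.uq
  have nur : ¬ TEdge G u r := S.F.mirror.lemD hch (by simpa using S.r_mem) S.vr
  have nd := S.nd
  have m1 := sI.last_mem
  have m2 := sK.head_mem
  have m3 := S.sJ.head_mem
  simp [List.nodup_append, List.nodup_cons] at nd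
  have d1 : u ≠ q0 := by rintro rfl; grind
  have d2 : u ≠ r := by rintro rfl; grind
  have d3 : q0 ≠ r := by rintro rfl; grind
  have d4 : v ≠ r1 := by rintro rfl; grind
  have d5 : v ≠ q := by rintro rfl; grind
  have d6 : r1 ≠ q := by rintro rfl; grind
  have d7 : u ≠ q1 := by rintro rfl; grind
  have d8 : q0 ≠ q1 := by rintro rfl; grind
  have tq0r : TEdge G q0 r := by
    rcases claw3 hch S.uq.symm hq0.symm S.qr d1 d2 d3 with h | h | h
    · exact absurd h nuq0
    · exact absurd h nur
    · exact h
  have tqr1 : TEdge G r1 q := by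
    rcases claw3 hch S.vr.symm hr1 S.qr.symm d4 d5 d6 with h | h | h
    · exact absurd h nvr1
    · exact absurd h nvq
    · exact h
  rcases claw3 hch S.uq.symm hq0.symm S.qq1 d1 d7 d8 with h | h | h
  · exact nuq0 h
  · have t := S.F.fv2 r S.r_mem S.vr
    have p := Seg.consL h (S.sJ.toT.app (te_adj S.rr0.symm) (.consL t (S.F.s2.toT.app S.u0u1
      (sI.toT.app (te_adj hq0) (.consL (te_symm tqr1) (sK.toT.app (te_adj S.F.ev0.symm)
        (.single v)))))))
    refine S.F.hNo _ p (List.perm_iff_count.2 (fun a => ?_))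
    rw [S.hQ]
    simp only [List.count_append, List.count_cons, List.count_nil]
    omega
  · have p := Seg.consL (te_adj S.uq) (.consL (te_symm tqr1) (sK.toT.app (te_symm S.v1v0)
      (S.F.s2.toT.app S.u0u1 (sI.toT.app h (S.sJ.toT.app (te_adj S.rr0.symm)
        (.consL (te_adj S.vr.symm) (.single v)))))))
    refine S.F.hNo _ p (List.perm_iff_count.2 (fun a => ?_))
    rw [S.hQ]
    simp only [List.count_append, List.count_cons, List.count_nil]
    omega

end Strand

end StrandSec
/-! ### Choosing the cycle -/

section CycleChoice

variable {V : Type*}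

/-- `L` is a cyclic list for the relation `T`. -/
def Cyc (T : V → V → Prop) (L : List V) : Prop := ∃ a b, Seg T a b L ∧ T b a

theorem Seg.split_at {T : V → V → Prop} {s t a b : V} {L l1 l2 : List V} (h : Seg T s t L)
    (e : L = l1 ++ a :: b :: l2) :
    Seg T s a (l1 ++ [a]) ∧ T a b ∧ Seg T b t (b :: l2) := by
  subst e
  rw [show l1 ++ a :: b :: l2 = (l1 ++ [a]) ++ b :: l2 by simp] at h
  obtain ⟨i, j, h1, h2, h3⟩ := h.split (by simp) (by simp)
  have e1 : i = a := by
    have := h1.lst; rw [List.getLast?_append] at this; simpa using this.symm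
  have e2 := h3.head_eq
  subst e1; subst e2
  exact ⟨h1, h2, h3⟩

theorem count_pq (p q : V → Prop) [DecidablePred p] [DecidablePred q] {T : V → V → Prop}
    {s t : V} {M : List V} (hM : Seg T s t M)
    (hc : M.IsChain (fun a b => ¬ (p a ∧ q b))) (hl : ¬ p t) :
    M.countP (fun w => decide (p w)) + M.countP (fun w => decide (q w)) + 1
      ≤ M.length + (if q s then 1 else 0) := by
  induction M generalizing s with
  | nil => exact absurd rfl hM.ne_nil
  | cons c M ih =>
    by_cases hn : M = []
    · subst hn
      obtain ⟨rfl, rfl⟩ := hM.single_inv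
      simp [List.countP_cons, hl]
    · obtain ⟨rfl, d, h1, h2⟩ := hM.cons_inv hn
      have hc' : M.IsChain (fun a b => ¬ (p a ∧ q b)) := hc.tail
      have := ih h2 hc'
      obtain ⟨d', M', rfl⟩ := List.exists_cons_of_ne_nil hn
      have e := h2.head_eq
      subst e
      have hpq := (List.isChain_cons_cons.1 hc).1
      simp only [List.countP_cons, List.length_cons, decide_eq_true_eq] at this ⊢
      split_ifs at this ⊢ <;> first | omega | (exfalso; tauto)

open Classical in
theorem deg_count [Fintype V] (G : SimpleGraph V) {C : List V} (hC : C.Nodup) (x y : V)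
    (h : ∀ w, w ∉ C → ¬ (G.Adj x w ∧ G.Adj y w)) :
    dgr G x + dgr G y + C.length ≤ C.countP (fun w => decide (G.Adj x w)) +
      C.countP (fun w => decide (G.Adj y w)) + Fintype.card V := by
  have key : ∀ z, dgr G z = C.countP (fun w => decide (G.Adj z w)) +
      (Finset.univ.filter (fun w => G.Adj z w ∧ w ∉ C)).card := by
    intro z
    have e1 : dgr G z = (Finset.univ.filter (fun w => G.Adj z w)).card := by
      unfold dgr
      rw [← Set.ncard_coe_finset]
      congr 1
      ext w; simp
    have e2 : C.countP (fun w => decide (G.Adj z w)) =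
        (Finset.univ.filter (fun w => G.Adj z w ∧ w ∈ C)).card := by
      rw [List.countP_eq_length_filter, ← List.toFinset_card_of_nodup (hC.filter _)]
      congr 1
      ext w; simp [and_comm]
    rw [e1, e2, ← Finset.card_union_of_disjoint]
    · congr 1
      ext w; simp; tauto
    · rw [Finset.disjoint_left]; intro w; simp; tauto
  have h2 : (Finset.univ.filter (fun w => G.Adj x w ∧ w ∉ C)).card +
      (Finset.univ.filter (fun w => G.Adj y w ∧ w ∉ C)).card + C.length ≤ Fintype.card V := by
    rw [← List.toFinset_card_of_nodup hC, ← Finset.card_union_of_disjoint,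
      ← Finset.card_union_of_disjoint]
    · exact Finset.card_le_univ _
    · rw [Finset.disjoint_left]; intro w; simp; tauto
    · rw [Finset.disjoint_left]; intro w h1 h2
      simp at h1 h2
      exact h w h1.2 ⟨h1.1, h2.1⟩
  rw [key x, key y]
  omega

open Classical in
/-- number (0 or 1) of missing edges between two vertices -/
noncomputable def nb (G : SimpleGraph V) (a b : V) : ℕ := if G.Adj a b then 0 else 1

/-- number of missing edges along a list -/
noncomputable def badP (G : SimpleGraph V) : List V → ℕ
  | [] => 0
  | [_] => 0
  | a :: b :: L => nb G a b + badP G (b :: L)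

theorem nb_comm (G : SimpleGraph V) (a b : V) : nb G a b = nb G b a := by
  have h : G.Adj a b ↔ G.Adj b a := G.adj_comm a b
  unfold nb
  by_cases h1 : G.Adj a b
  · rw [if_pos h1, if_pos (h.1 h1)]
  · rw [if_neg h1, if_neg (fun hh => h1 (h.2 hh))]

theorem badP_app (G : SimpleGraph V) {T S : V → V → Prop} {a b c d : V} {L M : List V}
    (h : Seg T a b L) (h' : Seg S c d M) : badP G (L ++ M) = badP G L + badP G M + nb G b c := by
  induction L generalizing a with
  | nil => exact absurd rfl h.ne_nil
  | cons x L ih =>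
    by_cases hn : L = []
    · subst hn
      obtain ⟨rfl, rfl⟩ := h.single_inv
      obtain ⟨y, M', rfl⟩ := List.exists_cons_of_ne_nil h'.ne_nil
      have := h'.head_eq
      subst this
      simp [badP]; omega
    · obtain ⟨rfl, d, h1, h2⟩ := h.cons_inv hn
      obtain ⟨y, L', rfl⟩ := List.exists_cons_of_ne_nil hn
      have := ih h2
      simp only [List.cons_append, badP] at this ⊢
      omega

theorem badP_rev (G : SimpleGraph V) {T : V → V → Prop} {a b : V} {L : List V}
    (hT : ∀ x y, T x y → T y x) (h : Seg T a b L) : badP G L.reverse = badP G L := by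
  induction L generalizing a with
  | nil => exact absurd rfl h.ne_nil
  | cons x L ih =>
    by_cases hn : L = []
    · subst hn; rfl
    · obtain ⟨rfl, d, h1, h2⟩ := h.cons_inv hn
      rw [List.reverse_cons, badP_app G (h2.rev hT) (Seg.single (T := T) x), ih h2]
      obtain ⟨y, L', rfl⟩ := List.exists_cons_of_ne_nil hn
      have := h2.head_eq
      subst this
      simp [badP, nb_comm G x]
      omega

theorem badP_zero (G : SimpleGraph V) {T : V → V → Prop} {a b : V} {L : List V}
    (h : Seg T a b L) (h0 : badP G L = 0) : Seg G.Adj a b L := by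
  induction L generalizing a with
  | nil => exact absurd rfl h.ne_nil
  | cons x L ih =>
    by_cases hn : L = []
    · subst hn
      obtain ⟨rfl, rfl⟩ := h.single_inv
      exact .single x
    · obtain ⟨rfl, d, h1, h2⟩ := h.cons_inv hn
      obtain ⟨y, L', rfl⟩ := List.exists_cons_of_ne_nil hn
      have := h2.head_eq
      subst this
      simp only [badP] at h0
      have e1 : nb G x d = 0 := by omega
      have e2 : G.Adj x d := by
        unfold nb at e1; by_contra hh; simp [hh] at e1
      exact .consL e2 (ih h2 (by omega))

theorem badP_pos (G : SimpleGraph V) {T : V → V → Prop} {a b : V} {L : List V}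
    (h : Seg T a b L) (h0 : badP G L ≠ 0) :
    ∃ L1 L2 i j, L = L1 ++ L2 ∧ Seg T a i L1 ∧ Seg T j b L2 ∧ T i j ∧ ¬ G.Adj i j := by
  by_contra hcon
  push Not at hcon
  apply h0
  have hch : L.IsChain G.Adj := by
    rw [List.isChain_iff_forall_rel_of_append_cons_cons]
    intro x y l1 l2 e
    obtain ⟨h1, h2, h3⟩ := h.split_at e
    exact hcon _ _ _ _ (by simp [e]) h1 h3 h2
  clear h h0 hcon
  induction L with
  | nil => rfl
  | cons x L ih =>
    cases L with
    | nil => rfl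
    | cons y L =>
      rw [List.isChain_cons_cons] at hch
      have := ih hch.2
      simp [badP, nb, hch.1, this]

theorem exists_cycle [Fintype V] (G : SimpleGraph V) {a0 b0 : V} (h0 : G.Adj a0 b0) :
    ∃ C : List V, C.Nodup ∧ Cyc G.Adj C ∧ 2 ≤ C.length ∧
      ∀ L : List V, L.Nodup → Cyc (TEdge G) L → L.length ≤ C.length := by
  classical
  -- the maximum length
  have hbd : ∀ L : List V, L.Nodup → L.length ≤ Fintype.card V := fun L hL => hL.length_le_card
  let P : ℕ → Prop := fun m => ∃ L : List V, L.Nodup ∧ Cyc (TEdge G) L ∧ L.length = m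
  have hP2 : P 2 := ⟨[a0, b0], by simp [h0.ne], ⟨a0, b0, .consL (te_adj h0) (.single b0),
    te_adj h0.symm⟩, rfl⟩
  have h2n : 2 ≤ Fintype.card V := by
    obtain ⟨L, h1, -, h2⟩ := hP2
    have := hbd L h1; omega
  obtain ⟨m, hPm, hm⟩ : ∃ m, P m ∧ ∀ k, P k → k ≤ m := by
    refine ⟨Nat.findGreatest P (Fintype.card V), Nat.findGreatest_spec h2n hP2, ?_⟩
    intro k hk
    refine Nat.le_findGreatest ?_ hk
    obtain ⟨L, h1, -, h2⟩ := hk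
    have := hbd L h1; omega
  -- the minimum number of missing edges
  let Q : ℕ → Prop := fun k => ∃ (L : List V) (a b : V), L.Nodup ∧ TSeg G a b L ∧ TEdge G b a ∧
    L.length = m ∧ badP G L + nb G b a = k
  have hQ : ∃ k, Q k := by
    obtain ⟨L, h1, ⟨a, b, h2, h3⟩, h4⟩ := hPm
    exact ⟨_, L, a, b, h1, h2, h3, h4, rfl⟩
  have hspec := Nat.find_spec hQ
  have hmin : ∀ k, Q k → Nat.find hQ ≤ k := fun k hk => Nat.find_min' hQ hk
  generalize Nat.find hQ = k at hspec hmin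
  have hk0 : k = 0 := by
    by_contra hk
    obtain ⟨L, x, y, hnd, hs, hT, hlen, hnE, hbk⟩ : ∃ (L : List V) (x y : V), L.Nodup ∧
        TSeg G y x L ∧ TEdge G x y ∧ L.length = m ∧ ¬ G.Adj x y ∧ badP G L + 1 ≤ k := by
      obtain ⟨L, a, b, h1, h2, h3, h4, h5⟩ := hspec
      by_cases hab : G.Adj b a
      · have hnb : nb G b a = 0 := by simp [nb, hab]
        obtain ⟨L1, L2, i, j, rfl, k1, k2, k3, k4⟩ := badP_pos G h2 (by omega)
        refine ⟨L2 ++ L1, i, j, ?_, k2.app h3 k1, k3, ?_, k4, ?_⟩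
        · exact (List.perm_append_comm.nodup_iff).1 h1
        · simp at h4 ⊢; omega
        · rw [badP_app G k1 k2] at h5
          rw [badP_app G k2 k1]
          have : nb G i j = 1 := by simp [nb, k4]
          omega
      · have hnb : nb G b a = 1 := by simp [nb, hab]
        exact ⟨L, b, a, h1, h2, h3, h4, hab, by omega⟩
    have hHP : HP G x y := (te_cases hT).resolve_left hnE
    have hout : ∀ w, w ∉ L → ¬ (G.Adj x w ∧ G.Adj y w) := by
      rintro w hw ⟨hxw, hyw⟩
      have := hm (m + 1) ⟨L ++ [w], by simp [List.nodup_append, hnd]; grind,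
        ⟨y, w, hs.app (te_adj hxw) (.single w), te_adj hyw.symm⟩, by simp [hlen]⟩
      omega
    have hchn : L.IsChain (fun a b => ¬ (G.Adj x a ∧ G.Adj y b)) := by
      rw [List.isChain_iff_forall_rel_of_append_cons_cons]
      rintro a b l1 l2 e ⟨hxa, hyb⟩
      obtain ⟨s1, s2, s3⟩ := hs.split_at e
      have e' : L = (l1 ++ [a]) ++ b :: l2 := by simp [e]
      have hb : badP G L = _ := (congrArg (badP G) e').trans (badP_app G s1 s3)
      have := hmin _ ⟨(l1 ++ [a]) ++ (b :: l2).reverse, y, b, ?_,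
        s1.app (te_adj hxa.symm) s3.revT, te_adj hyb.symm, ?_, rfl⟩
      · rw [badP_app G s1 s3.revT, badP_rev G (fun _ _ h => te_symm h) s3] at this
        have e1 : nb G a x = 0 := by simp [nb, hxa.symm]
        have e2 : nb G b y = 0 := by simp [nb, hyb.symm]
        omega
      · rw [e'] at hnd
        exact ((List.Perm.append_left _ (List.reverse_perm _)).nodup_iff).2 hnd
      · rw [e'] at hlen
        simp at hlen ⊢; omega
    have h1 := count_pq (G.Adj x) (G.Adj y) hs hchn (by simp)
    have h2 := deg_count G hnd x y hout
    unfold HP at hHP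
    simp at h1
    omega
  obtain ⟨L, a, b, h1, h2, h3, h4, h5⟩ := hspec
  have hE := badP_zero G h2 (by omega)
  have hE' : G.Adj b a := by
    have : nb G b a = 0 := by omega
    unfold nb at this; by_contra hh; simp [hh] at this
  refine ⟨L, h1, ⟨a, b, hE, hE'⟩, ?_, ?_⟩
  · rw [h4]; exact hm 2 hP2
  · intro L' h1' h2'
    rw [h4]; exact hm _ ⟨L', h1', h2', rfl⟩

end CycleChoice
/-! ### Longest cycles and the component outside -/

section MaxSec

variable {V : Type*} [Fintype V] {G : SimpleGraph V}

/-- A cycle which is at least as long as every cyclic list of `TEdge`s. -/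
structure MaxCyc (G : SimpleGraph V) (C : List V) : Prop where
  nd : C.Nodup
  cyc : Cyc G.Adj C
  mx : ∀ L : List V, L.Nodup → Cyc (TEdge G) L → L.length ≤ C.length

theorem Cyc.rot {T : V → V → Prop} {L M : List V} (h : Cyc T (L ++ M)) : Cyc T (M ++ L) := by
  by_cases hL : L = []
  · subst hL; simpa using h
  by_cases hM : M = []
  · subst hM; simpa using h
  obtain ⟨a, b, h1, h2⟩ := h
  obtain ⟨c, d, k1, k2, k3⟩ := h1.split hL hM
  exact ⟨d, c, k3.app h2 k1, k2⟩

namespace MaxCyc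

theorem rot {L M : List V} (h : MaxCyc G (L ++ M)) : MaxCyc G (M ++ L) := by
  refine ⟨(List.perm_append_comm.nodup_iff).1 h.nd, h.cyc.rot, ?_⟩
  intro L' h1 h2
  have := h.mx L' h1 h2
  simp at this ⊢; omega

theorem noExt {C : List V} (h : MaxCyc G C) {a b c d : V} {L P : List V} (hL : TSeg G a b L)
    (hp : L.Perm C) (hP : TSeg G c d P) (hPn : P.Nodup) (hPC : ∀ p ∈ P, p ∉ C)
    (hbc : TEdge G b c) (hda : TEdge G d a) : False := by
  have h1 := h.mx (L ++ P) ?_ ⟨a, d, hL.app hbc hP, hda⟩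
  · have := hp.length_eq
    have := List.length_pos_of_ne_nil hP.ne_nil
    simp at h1; omega
  · rw [List.nodup_append]
    refine ⟨hp.nodup_iff.2 h.nd, hPn, ?_⟩
    rintro x hx y hy rfl
    exact hPC x hy (hp.mem_iff.1 hx)

theorem ins {C : List V} (h : MaxCyc G C) {a b w : V} {L : List V} (hL : TSeg G a b L)
    (hp : L.Perm C) (hw : w ∉ C) (hbc : TEdge G w b) (hda : TEdge G w a) : False :=
  h.noExt hL hp (.single w) (by simp) (by simpa using hw) (te_symm hbc) hda

/-- Lemma Y. -/
theorem lemY (hch : ClawHeavy G) {s x u : V} {M : List V} (h : MaxCyc G (s :: M))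
    (hx : x ∉ s :: M) (hdis : ∀ w, w ∉ s :: M → ¬ (G.Adj x w ∧ G.Adj s w)) (hu : u ∈ M)
    (hxu : G.Adj x u) (hsu : G.Adj s u) (hxs : ¬ G.Adj x s) : ¬ TEdge G x s := by
  classical
  intro hT
  have nd := h.nd
  obtain ⟨a, s0, h1, h2⟩ := h.cyc
  have hM : M ≠ [] := by rintro rfl; simp at hu
  obtain ⟨rfl, s1, hss1, sM⟩ := h1.cons_inv hM
  -- an attachment vertex of `x` is neither the first nor the last element of `M`
  have hmid : ∀ (M1 M2 : List V) (a : V), M = M1 ++ a :: M2 → G.Adj x a → M1 ≠ [] ∧ M2 ≠ [] := by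
    intro M1 M2 a e hxa
    constructor
    · rintro rfl
      have ea : s1 = a := by
        rw [e] at sM; exact sM.head_eq
      subst ea
      refine h.ins (sM.toT.app (te_adj h2) (.single s)) (List.perm_append_comm) hx hT (te_adj hxa)
    · rintro rfl
      have ea : s0 = a := by
        have := sM.lst
        rw [e, List.getLast?_append] at this
        simpa using this.symm
      subst ea
      exact h.ins h1.toT (List.Perm.refl _) hx (te_adj hxa) hT
  have t10 : TEdge G s1 s0 := by
    obtain ⟨M1, M2, e⟩ := List.append_of_mem hu
    obtain ⟨hn1, hn2⟩ := hmid M1 M2 u e hxu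
    have sM' := sM
    rw [e] at sM' nd hx
    obtain ⟨p, u', k1, k2, k3⟩ := sM'.split hn1 (by simp)
    have eu := k3.head_eq
    subst eu
    obtain ⟨-, f, k4, k5⟩ := k3.cons_inv hn2
    have m1 := k1.head_mem
    have m2 := k1.last_mem
    have m3 := k5.head_mem
    have m4 := k5.last_mem
    simp [List.nodup_append, List.nodup_cons] at nd hx
    have hpc : (u' :: M2 ++ s :: M1).Perm (s :: M) := by
      rw [e]
      refine List.perm_iff_count.2 (fun a => ?_)
      simp only [List.count_append, List.count_cons]
      omega
    have hx' : x ∉ s :: M := by rw [e]; simp; tauto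
    have tpf : TEdge G p f := by
      have d1 : x ≠ p := by rintro rfl; tauto
      have d2 : x ≠ f := by rintro rfl; tauto
      have d3 : p ≠ f := by rintro rfl; grind
      rcases claw3 hch hxu.symm k2.symm k4 d1 d2 d3 with hh | hh | hh
      · exfalso
        exact h.ins (k3.toT.app (te_adj h2) (.consL (te_adj hss1) k1.toT)) hpc hx' hh (te_adj hxu)
      · exfalso
        refine h.ins (k5.toT.app (te_adj h2) (.consL (te_adj hss1) (k1.toT.app (te_adj k2)
          (.single u')))) ?_ hx' (te_adj hxu) hh
        rw [e]
        refine List.perm_iff_count.2 (fun a => ?_)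
        simp only [List.count_append, List.count_cons, List.count_nil]
        omega
      · exact hh
    have d1 : u' ≠ s1 := by rintro rfl; grind
    have d2 : u' ≠ s0 := by rintro rfl; grind
    have d3 : s1 ≠ s0 := by rintro rfl; grind
    rcases claw3 hch hsu hss1 h2.symm d1 d2 d3 with hh | hh | hh
    · exfalso
      refine h.ins (.consL hh (k1.toT.app tpf (k5.toT.app (te_adj h2) (.single s)))) ?_ hx' hT
        (te_adj hxu)
      rw [e]
      refine List.perm_iff_count.2 (fun a => ?_)
      simp only [List.count_append, List.count_cons, List.count_nil]
      omega
    · exfalso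
      refine h.ins (.consL hh (k5.toT.revT.app (te_symm tpf) (k1.toT.revT.app (te_adj hss1.symm)
        (.single s)))) ?_ hx' hT (te_adj hxu)
      rw [e]
      refine List.perm_iff_count.2 (fun a => ?_)
      simp only [List.count_append, List.count_cons, List.count_nil, List.count_reverse]
      omega
    · exact hh
  have hchn : M.IsChain (fun a b => ¬ (G.Adj x a ∧ G.Adj s b)) := by
    rw [List.isChain_iff_forall_rel_of_append_cons_cons]
    rintro a b l1 l2 e ⟨hxa, hsb⟩
    obtain ⟨hn1, -⟩ := hmid l1 (b :: l2) a e hxa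
    have sM' := sM
    rw [e] at sM'
    obtain ⟨p, a', k1, k2, k3⟩ := sM'.split hn1 (by simp)
    have ea := k3.head_eq
    subst ea
    obtain ⟨-, b', k4, k5⟩ := k3.cons_inv (by simp)
    have eb := k5.head_eq
    subst eb
    refine h.ins (.consL (te_adj k2.symm) (k1.toT.revT.app t10 (k5.toT.revT.app (te_adj hsb.symm)
      (.single s)))) ?_ hx hT (te_adj hxa)
    rw [e]
    refine List.perm_iff_count.2 (fun a => ?_)
    simp only [List.count_append, List.count_cons, List.count_nil, List.count_reverse]
    omega
  have hl : ¬ G.Adj x s0 := by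
    intro hh
    obtain ⟨M1, e⟩ : ∃ M1, M = M1 ++ [s0] := by
      refine ⟨M.dropLast, ?_⟩
      exact (List.dropLast_append_getLast? s0 sM.lst).symm
    exact (hmid M1 [] s0 e hh).2 rfl
  have c1 := count_pq (G.Adj x) (G.Adj s) sM hchn hl
  have c2 := deg_count G (C := x :: s :: M) (List.nodup_cons.2 ⟨hx, h.nd⟩) x s ?_
  · have hHP : HP G x s := (te_cases hT).resolve_left hxs
    unfold HP at hHP
    have hsx : ¬ G.Adj s x := fun hh => hxs hh.symm
    simp only [List.countP_cons, List.length_cons, hxs, hsx,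
      SimpleGraph.irrefl, decide_false, hss1, if_true] at c1 c2
    simp [hsx] at c1 c2
    omega
  · intro w hw
    refine hdis w (fun hh => hw (List.mem_cons_of_mem _ hh))

end MaxCyc

/-- A path inside a connected set, as a list. -/
theorem exists_path_list {R : Set V} (hR : (G.induce R).Connected) {x y : V} (hx : x ∈ R)
    (hy : y ∈ R) : ∃ P : List V, ESeg G x y P ∧ P.Nodup ∧ ∀ p ∈ P, p ∈ R := by
  classical
  obtain ⟨w, hw⟩ := (hR.preconnected ⟨x, hx⟩ ⟨y, hy⟩).exists_isPath
  refine ⟨w.support.map Subtype.val, ⟨?_, ?_, ?_⟩, ?_, ?_⟩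
  · rw [List.isChain_map]
    exact w.isChain_adj_support
  · rw [List.head?_map, List.head?_eq_some_head w.support_ne_nil]; simp
  · rw [List.getLast?_map, List.getLast?_eq_some_getLast w.support_ne_nil]; simp
  · exact hw.support_nodup.map Subtype.val_injective
  · intro p hp
    simp at hp
    exact hp.1

/-- `R` is outside `C`, connected, and all its outgoing edges go to `C`. -/
structure Comp (G : SimpleGraph V) (C : List V) (R : Set V) : Prop where
  out : ∀ w ∈ R, w ∉ C
  conn : (G.induce R).Connected
  closed : ∀ w ∈ R, ∀ z, G.Adj w z → z ∈ R ∨ z ∈ C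

theorem exists_frame (hch : ClawHeavy G) {u v x y : V} {Q1 Q2 : List V} {R : Set V}
    (hM : MaxCyc G (u :: Q1 ++ v :: Q2)) (hR : Comp G (u :: Q1 ++ v :: Q2) R)
    (hx : x ∈ R) (hy : y ∈ R) (hxu : G.Adj x u) (hyv : G.Adj y v)
    (hQ1 : ∀ s ∈ Q1, ∀ w ∈ R, ¬ G.Adj w s) :
    ∃ u1 v0 v1 u0, Frame G u v u1 v0 v1 u0 Q1 Q2 ∧ (∀ w ∈ R, G.Adj w u → ¬ G.Adj w u0) ∧
      (∀ w ∈ R, G.Adj w v → ¬ G.Adj w v1) := by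
  classical
  have nd := hM.nd
  obtain ⟨P, sP, ndP, hPR⟩ := exists_path_list hR.conn hx hy
  have hNo : ∀ L, TSeg G u v L → L.Perm (u :: Q1 ++ v :: Q2) → False := by
    intro L hL hp
    refine hM.noExt hL hp sP.toT.revT (by simpa using ndP) ?_ (te_symm (te_adj hyv)) (te_adj hxu)
    intro p hp'
    exact hR.out p (hPR p (by simpa using hp'))
  obtain ⟨a, u0, sC, hu0⟩ := hM.cyc
  have ea : a = u := sC.head_eq
  subst ea
  have hQ1n : Q1 ≠ [] := by
    rintro rfl
    have hr := Cyc.rot (L := [a]) (M := v :: Q2) hM.cyc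
    obtain ⟨c, d, h1, h2⟩ := hr
    have e1 : c = v := h1.head_eq
    have e2 : d = a := by
      have := h1.lst; rw [List.getLast?_append] at this; simpa using this.symm
    subst e1; subst e2
    refine hNo _ h1.toT.revT ((List.reverse_perm _).trans ?_)
    exact List.perm_append_comm
  have hQ2n : Q2 ≠ [] := by
    rintro rfl
    have e : u0 = v := by
      have := sC.lst; rw [List.getLast?_append] at this; simpa using this.symm
    subst e
    exact hNo _ sC.toT (List.Perm.refl _)
  obtain ⟨-, u1, huu1, s1⟩ := (show ESeg G a u0 (a :: (Q1 ++ v :: Q2)) from sC).cons_inv (by simp)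
  obtain ⟨v0, v', sQ1, hv0, s2⟩ := s1.split hQ1n (by simp)
  have ev := s2.head_eq
  subst ev
  obtain ⟨-, v1, hv1, sQ2⟩ := s2.cons_inv hQ2n
  -- Lemma Y
  have hY : ∀ w ∈ R, ∀ s ∈ Q1, ∀ t, t ∈ a :: Q1 ++ v' :: Q2 → G.Adj w t → G.Adj t s →
      ¬ TEdge G w s := by
    intro w hw s hs t ht hwt hts
    obtain ⟨I, K, e⟩ := List.append_of_mem hs
    have hM' : MaxCyc G ((s :: (K ++ v' :: Q2)) ++ (a :: I)) := by
      refine MaxCyc.rot (L := a :: I) (M := s :: (K ++ v' :: Q2)) ?_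
      have : (a :: I) ++ s :: (K ++ v' :: Q2) = a :: Q1 ++ v' :: Q2 := by simp [e]
      rw [this]; exact hM
    have hmem : ∀ z, z ∈ (s :: (K ++ v' :: Q2)) ++ (a :: I) ↔ z ∈ a :: Q1 ++ v' :: Q2 := by
      intro z; rw [e]; simp; tauto
    have hM'' : MaxCyc G (s :: ((K ++ v' :: Q2) ++ (a :: I))) := hM'
    refine hM''.lemY hch (fun h => hR.out w hw ((hmem w).1 h)) ?_ ?_ hwt hts.symm (hQ1 s hs w hw)
    · rintro z hz ⟨h1, h2⟩
      rcases hR.closed w hw z h1 with h | h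
      · exact hQ1 s hs z h h2.symm
      · exact hz ((hmem z).2 h)
    · have := (hmem t).2 ht
      simp only [List.cons_append, List.mem_cons] at this
      rcases this with h | h
      · exact absurd h hts.ne
      · exact h
  have hwu0 : ∀ w ∈ R, G.Adj w a → ¬ TEdge G w u0 := by
    intro w hw hwa hT
    exact hM.ins sC.toT (List.Perm.refl _) (hR.out w hw) hT (te_adj hwa)
  have hwv1 : ∀ w ∈ R, G.Adj w v' → ¬ TEdge G w v1 := by
    intro w hw hwa hT
    refine hM.ins (sQ2.toT.app (te_adj hu0) (.consL (te_adj huu1) (sQ1.toT.app (te_adj hv0)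
      (.single v')))) ?_ (hR.out w hw) (te_adj hwa) hT
    refine List.perm_iff_count.2 (fun a => ?_)
    simp only [List.count_append, List.count_cons, List.count_nil]
    omega
  have hne : ∀ w ∈ R, ∀ s, s ∈ a :: Q1 ++ v' :: Q2 → w ≠ s := by
    rintro w hw s hs rfl; exact hR.out w hw hs
  have hQm : ∀ s ∈ Q1, s ∈ a :: Q1 ++ v' :: Q2 := by intro s hs; simp [hs]
  have mu0 := sQ2.last_mem
  have mv1 := sQ2.head_mem
  refine ⟨u1, v0, v1, u0, ⟨sQ1, sQ2, huu1, hv0.symm, hv1, hu0.symm, nd, hNo, ?_, ?_, ?_, ?_⟩,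
    fun w hw h1 h2 => hwu0 w hw h1 (te_adj h2), fun w hw h1 h2 => hwv1 w hw h1 (te_adj h2)⟩
  · intro s hs s' hs' h1 h2 hss
    rcases claw3 hch hxu.symm h1 h2 (hne x hx s (hQm s hs)) (hne x hx s' (hQm s' hs')) hss with
      h | h | h
    · exact absurd h (hY x hx s hs a (by simp) hxu h1)
    · exact absurd h (hY x hx s' hs' a (by simp) hxu h2)
    · exact h
  · intro s hs h1
    have hss : s ≠ u0 := by
      rintro rfl
      simp [List.nodup_append, List.nodup_cons] at nd
      grind
    rcases claw3 hch hxu.symm h1 hu0.symm (hne x hx s (hQm s hs)) (hne x hx u0 (by simp [mu0])) hss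
      with h | h | h
    · exact absurd h (hY x hx s hs a (by simp) hxu h1)
    · exact absurd h (hwu0 x hx hxu)
    · exact h
  · intro s hs s' hs' h1 h2 hss
    rcases claw3 hch hyv.symm h1 h2 (hne y hy s (hQm s hs)) (hne y hy s' (hQm s' hs')) hss with
      h | h | h
    · exact absurd h (hY y hy s hs v' (by simp) hyv h1)
    · exact absurd h (hY y hy s' hs' v' (by simp) hyv h2)
    · exact h
  · intro s hs h1
    have hss : s ≠ v1 := by
      rintro rfl
      simp [List.nodup_append, List.nodup_cons] at nd
      grind
    rcases claw3 hch hyv.symm h1 hv1 (hne y hy s (hQm s hs)) (hne y hy v1 (by simp [mv1])) hss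
      with h | h | h
    · exact absurd h (hY y hy s hs v' (by simp) hyv h1)
    · exact absurd h (hwv1 y hy hyv)
    · exact h

end MaxSec

/-! ### Final assembly -/

theorem list_first {V : Type*} (p : V → Prop) (L : List V) (h : ∃ a ∈ L, p a) :
    ∃ L1 a L2, L = L1 ++ a :: L2 ∧ p a ∧ ∀ b ∈ L1, ¬ p b := by
  induction L with
  | nil => simp at h
  | cons c M ih =>
    by_cases hc : p c
    · exact ⟨[], c, M, rfl, hc, by simp⟩
    · obtain ⟨a, ha, hpa⟩ := h
      have haM : a ∈ M := by
        rcases List.mem_cons.1 ha with rfl | h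
        · exact absurd hpa hc
        · exact h
      obtain ⟨L1, a', L2, e, h1, h2⟩ := ih ⟨a, haM, hpa⟩
      refine ⟨c :: L1, a', L2, by simp [e], h1, ?_⟩
      intro b hb
      rcases List.mem_cons.1 hb with rfl | h
      · exact hc
      · exact h2 b h

theorem list_last {V : Type*} (p : V → Prop) (L : List V) (h : ∃ a ∈ L, p a) :
    ∃ L1 a L2, L = L1 ++ a :: L2 ∧ p a ∧ ∀ b ∈ L2, ¬ p b := by
  obtain ⟨L1, a, L2, e, h1, h2⟩ := list_first p L.reverse (by simpa using h)
  refine ⟨L2.reverse, a, L1.reverse, ?_, h1, by simpa using h2⟩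
  have := congrArg List.reverse e
  simpa using this

section Final

variable {V : Type*} [Fintype V] {G : SimpleGraph V}

theorem no_frame (hch : ClawHeavy G) (hadh : AlmostDH G) {u v x y : V} {Q1 Q2 : List V}
    {R : Set V} (hM : MaxCyc G (u :: Q1 ++ v :: Q2)) (hR : Comp G (u :: Q1 ++ v :: Q2) R)
    (hx : x ∈ R) (hy : y ∈ R) (hxu : G.Adj x u) (hyv : G.Adj y v)
    (hQ1 : ∀ s ∈ Q1, ∀ w ∈ R, ¬ G.Adj w s) : False := by
  classical
  obtain ⟨u1, v0, v1, u0, F, hu0, hv1⟩ := exists_frame hch hM hR hx hy hxu hyv hQ1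
  obtain ⟨I, q, N, eQ, huq, hN⟩ := list_last (G.Adj u) Q1 ⟨u1, F.s1.head_mem, F.eu1⟩
  have hqQ : q ∈ Q1 := by simp [eQ]
  have hvq : ¬ TEdge G v q := F.lemD hch hqQ huq
  have s1 := F.s1
  rw [eQ, show I ++ q :: N = (I ++ [q]) ++ N by simp] at s1
  have hNn : N ≠ [] := by
    rintro rfl
    have : v0 = q := by
      have := s1.lst; simpa using this.symm
    subst this
    exact hvq (te_adj F.ev0)
  obtain ⟨q', q1, sI, hq1, sN⟩ := s1.split (by simp) hNn
  have e1 : q' = q := by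
    have := sI.lst; simpa using this.symm
  subst e1
  obtain ⟨J, r, K, eN, hvr, hJ⟩ := list_first (G.Adj v) N ⟨v0, sN.last_mem, F.ev0⟩
  have hJn : J ≠ [] := by
    rintro rfl
    refine F.touch1 (I := I ++ [q']) (J := N) (by simp [eQ]) sI.toT sN.toT (te_adj huq)
      (te_adj ?_)
    have sN' := sN
    rw [eN] at sN'
    have e := sN'.head_eq
    rw [e]; exact hvr
  have sN' := sN
  rw [eN] at sN'
  obtain ⟨r0, r', sJ, hr, sK⟩ := sN'.split hJn (by simp)
  have e2 := sK.head_eq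
  subst e2
  have nd := F.nd
  have hQ : Q1 = I ++ q' :: (J ++ r' :: K) := by rw [eQ, eN]
  have hRQ : ∀ s ∈ Q1, s ∉ R := fun s hs hsR => hR.out s hsR (by simp [hs])
  have hvR : v ∉ R := fun h => hR.out v h (by simp)
  have hrQ : r' ∈ Q1 := by simp [hQ]
  have hJQ : ∀ s ∈ J, s ∈ Q1 := by intro s hs; simp [hQ, hs]
  have hvQ : v ∉ Q1 := by
    intro h
    simp [List.nodup_append] at nd
    grind
  have ndQ : Q1.Nodup := by
    have : Q1.Sublist (u :: Q1 ++ v :: Q2) := by simp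
    exact nd.sublist this
  have nJr : r' ∉ J := by
    intro h; rw [hQ] at ndQ; simp [List.nodup_append] at ndQ; grind
  have nJq : q' ∉ J := by
    intro h; rw [hQ] at ndQ; simp [List.nodup_append] at ndQ; grind
  have nqr : q' ≠ r' := by
    rintro h; rw [hQ] at ndQ; simp [List.nodup_append] at ndQ; grind
  have hvq' : ¬ G.Adj v q' := fun h => hvq (te_adj h)
  -- the set
  have sT : ESeg G v q' (v :: r' :: (J.reverse ++ [q'])) :=
    .consL hvr (.consL hr.symm (sJ.revE.app hq1.symm (.single q')))
  have hc : (G.induce (R ∪ {z | z ∈ v :: r' :: (J.reverse ++ [q'])})).Connected :=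
    SimpleGraph.connected_induce_union hR.conn.preconnected (seg_connected sT).preconnected
      hy (by simp) hyv
  have hmem : ∀ a, a ∈ R ∪ {z | z ∈ v :: r' :: (J.reverse ++ [q'])} →
      a ∈ R ∨ a = v ∨ a = r' ∨ a ∈ J ∨ a = q' := by
    intro a ha; simpa using ha
  have ma : q' ∈ R ∪ {z | z ∈ v :: r' :: (J.reverse ++ [q'])} := by simp
  have mb : x ∈ R ∪ {z | z ∈ v :: r' :: (J.reverse ++ [q'])} := Or.inl hx
  have hqR := hRQ q' hqQ
  have hrR := hRQ r' hrQ
  have hvr' : v ≠ r' := fun h => hvQ (h ▸ hrQ)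
  have hvqn : v ≠ q' := fun h => hvQ (h ▸ hqQ)
  have hqr : G.Adj q' r' := by
    by_contra hqr
    let f : V → ℕ := fun w => if w ∈ R then 4 else if w = v then 3 else if w = r' then 2 else
      if w = q' then 0 else 1
    have fR : ∀ w ∈ R, f w = 4 := fun w hw => by simp [f, hw]
    have fv : f v = 3 := by simp [f, hvR]
    have fr : f r' = 2 := by simp [f, hrR, hvr'.symm]
    have fq : f q' = 0 := by simp [f, hqR, hvqn.symm, nqr]
    have fJ : ∀ w ∈ J, f w = 1 := by
      intro w hw
      have h1 := hRQ w (hJQ w hw)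
      have h2 : w ≠ v := by rintro rfl; exact hvQ (hJQ _ hw)
      have h3 : w ≠ r' := by rintro rfl; exact nJr hw
      have h4 : w ≠ q' := by rintro rfl; exact nJq hw
      simp [f, h1, h2, h3, h4]
    have := adh_pot hadh _ hc f ?_ ma mb huq.symm hxu.symm
    · rw [fR x hx, fq] at this; omega
    · intro a ha b hb hab
      rcases hmem b hb with h | rfl | rfl | h | rfl
      · rw [fR b h]
        rcases hmem a ha with h' | rfl | rfl | h' | rfl
        · rw [fR a h']; omega
        · omega
        · exact absurd hab.symm (hQ1 _ hrQ b h)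
        · exact absurd hab.symm (hQ1 _ (hJQ _ h') b h)
        · exact absurd hab.symm (hQ1 _ hqQ b h)
      · rcases hmem a ha with h' | rfl | rfl | h' | rfl
        · rw [fR a h']; omega
        · omega
        · omega
        · exact absurd hab.symm (hJ _ h')
        · exact absurd hab.symm hvq'
      · rcases hmem a ha with h' | rfl | rfl | h' | rfl
        · rw [fR a h']; omega
        · omega
        · omega
        · rw [fJ a h']; omega
        · exact absurd hab hqr
      · rw [fJ b h]; omega
      · omega
  have hxv : G.Adj x v := by
    by_contra hxv
    let f : V → ℕ := fun w => if w ∈ R then (if G.Adj v w then 3 else 4) else if w = v then 2 else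
      if w = q' then 0 else 1
    have fR : ∀ w ∈ R, f w = if G.Adj v w then 3 else 4 := fun w hw => by simp [f, hw]
    have fR3 : ∀ w ∈ R, 3 ≤ f w ∧ f w ≤ 4 := fun w hw => by rw [fR w hw]; split_ifs <;> omega
    have fv : f v = 2 := by simp [f, hvR]
    have fr : f r' = 1 := by simp [f, hrR, hvr'.symm, nqr.symm]
    have fq : f q' = 0 := by simp [f, hqR, hvqn.symm]
    have fJ : ∀ w ∈ J, f w = 1 := by
      intro w hw
      have h1 := hRQ w (hJQ w hw)
      have h2 : w ≠ v := by rintro rfl; exact hvQ (hJQ _ hw)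
      have h4 : w ≠ q' := by rintro rfl; exact nJq hw
      simp [f, h1, h2, h4]
    have := adh_pot hadh _ hc f ?_ ma mb huq.symm hxu.symm
    · rw [fR x hx, fq, if_neg (fun h => hxv h.symm)] at this; omega
    · intro a ha b hb hab
      rcases hmem b hb with h | rfl | rfl | h | rfl
      · rcases hmem a ha with h' | rfl | rfl | h' | rfl
        · have := fR3 a h'; have := fR3 b h; omega
        · rw [fR b h, if_pos hab]; omega
        · exact absurd hab.symm (hQ1 _ hrQ b h)
        · exact absurd hab.symm (hQ1 _ (hJQ _ h') b h)
        · exact absurd hab.symm (hQ1 _ hqQ b h)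
      · rcases hmem a ha with h' | rfl | rfl | h' | rfl
        · have := fR3 a h'; omega
        · omega
        · omega
        · rw [fJ a h']; omega
        · exact absurd hab.symm hvq'
      · omega
      · rw [fJ b h]; omega
      · omega
  have S : Strand G u v u1 v0 v1 u0 Q1 Q2 I J K q' r' q1 r0 x :=
    ⟨F, hQ, sJ, hq1, hr.symm, huq, hvr, hqr, hxu, hxv, fun s hs => hQ1 s hs x hx,
      hu0 x hx hxu, hv1 x hx hxv⟩
  exact S.contra hch hadh

/-- The component of a vertex outside `C`. -/
theorem exists_comp (C : List V) {x0 : V} (h0 : x0 ∉ C) : ∃ R : Set V, x0 ∈ R ∧ Comp G C R := by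
  refine ⟨{w | ∃ P, ESeg G x0 w P ∧ ∀ p ∈ P, p ∉ C}, ⟨[x0], .single x0, by simpa using h0⟩, ?_⟩
  refine ⟨?_, ?_, ?_⟩
  · rintro w ⟨P, hP, hPC⟩
    exact hPC w hP.last_mem
  · refine SimpleGraph.induce_connected_of_patches x0 ⟨[x0], .single x0, by simpa using h0⟩ ?_
    rintro w ⟨P, hP, hPC⟩
    refine ⟨{p | p ∈ P}, ?_, hP.head_mem, hP.last_mem, (seg_connected hP).preconnected _ _⟩
    intro p hp
    obtain ⟨I, J, e⟩ := List.append_of_mem (show p ∈ P from hp)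
    by_cases hJ : J = []
    · subst hJ
      have : w = p := by
        have := hP.lst; rw [e] at this; simpa using this.symm
      subst this
      exact ⟨P, hP, hPC⟩
    · rw [e, show I ++ p :: J = (I ++ [p]) ++ J by simp] at hP
      obtain ⟨b, c, k1, -, -⟩ := hP.split (by simp) hJ
      have : b = p := by
        have := k1.lst; simpa using this.symm
      subst this
      refine ⟨_, k1, ?_⟩
      intro z hz
      refine hPC z ?_
      rw [e]; simp at hz ⊢; tauto
  · rintro w ⟨P, hP, hPC⟩ z hwz
    by_cases hz : z ∈ C
    · exact Or.inr hz
    · refine Or.inl ⟨P ++ [z], hP.app hwz (.single z), ?_⟩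
      intro p hp
      rcases List.mem_append.1 hp with h | h
      · exact hPC p h
      · simp at h; subst h; exact hz

/-- The component has an attachment vertex different from `c`. -/
theorem exists_att (h2conn : ∀ v : V, (G.induce {v}ᶜ).Connected) {C : List V} {R : Set V}
    (hR : Comp G C R) {x0 c c' : V} (hx0 : x0 ∈ R) (hc : c ∈ C) (hc' : c' ∈ C) (hne : c' ≠ c) :
    ∃ a ∈ C, a ≠ c ∧ ∃ w ∈ R, G.Adj w a := by
  have hxc : x0 ≠ c := by rintro rfl; exact hR.out _ hx0 hc
  obtain ⟨p⟩ := (h2conn c).preconnected ⟨x0, hxc⟩ ⟨c', hne⟩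
  obtain ⟨d, -, hd1, hd2⟩ := p.exists_boundary_dart {z | (z : V) ∈ R} hx0
    (fun h => hR.out _ h hc')
  have hadj : G.Adj (d.fst : V) (d.snd : V) := d.adj
  rcases hR.closed _ hd1 _ hadj with h | h
  · exact absurd h hd2
  · exact ⟨_, h, d.snd.2, _, hd1, hadj⟩

theorem maxCyc_spans (h2conn : ∀ v : V, (G.induce {v}ᶜ).Connected)
    (hch : ClawHeavy G) (hadh : AlmostDH G) {C : List V} (hM : MaxCyc G C) (h2 : 2 ≤ C.length)
    (x0 : V) : x0 ∈ C := by
  by_contra h0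
  obtain ⟨R, hx0, hR⟩ := exists_comp (G := G) C h0
  have hoth : ∀ c, ∃ c' ∈ C, c' ≠ c := by
    intro c
    match C, h2, hM.nd with
    | a :: b :: L, _, nd =>
      by_cases h : a = c
      · subst h
        refine ⟨b, by simp, ?_⟩
        rintro rfl
        simp at nd
      · exact ⟨a, by simp, h⟩
  obtain ⟨c, hc, -⟩ := hoth x0
  obtain ⟨c', hc', hne⟩ := hoth c
  obtain ⟨u, huC, -, x, hx, hxu⟩ := exists_att h2conn hR hx0 hc hc' hne
  obtain ⟨u', hu', hne'⟩ := hoth u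
  obtain ⟨v, hvC, hvu, y, hy, hyv⟩ := exists_att h2conn hR hx0 huC hu' hne'
  obtain ⟨A, B, e⟩ := List.append_of_mem huC
  obtain ⟨Q1, v', Q2, e2, ⟨y', hy', hyv'⟩, hQ1⟩ :=
    list_first (fun s => ∃ w ∈ R, G.Adj w s) (B ++ A) ⟨v, by
      rw [e] at hvC; simp at hvC ⊢; tauto, y, hy, hyv⟩
  have hl : (u :: B) ++ A = u :: Q1 ++ v' :: Q2 := by simp [e2]
  have hM' : MaxCyc G (u :: Q1 ++ v' :: Q2) := by
    rw [← hl]; rw [e] at hM; exact hM.rot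
  have hmem : ∀ z, z ∈ u :: Q1 ++ v' :: Q2 ↔ z ∈ C := by
    intro z; rw [← hl, e]; simp; tauto
  have hR' : Comp G (u :: Q1 ++ v' :: Q2) R :=
    ⟨fun w hw h => hR.out w hw ((hmem w).1 h), hR.conn, fun w hw z hz =>
      (hR.closed w hw z hz).imp id (hmem z).2⟩
  exact no_frame hch hadh hM' hR' hx hy' hxu hyv' (fun s hs w hw h => hQ1 s hs ⟨w, hw, h⟩)

theorem ham_of_cyc [DecidableEq V] (h3 : 3 ≤ Fintype.card V) {C : List V} (nd : C.Nodup)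
    (hC : Cyc G.Adj C) (hall : ∀ z, z ∈ C) : G.IsHamiltonian := by
  intro _
  have hlen : C.length = Fintype.card V := by
    rw [← List.toFinset_card_of_nodup nd, ← Finset.card_univ]
    congr 1
    ext z; simp [hall]
  obtain ⟨a, b, s, hba⟩ := hC
  have hw : ∃ p : G.Walk a b, p.support = C := by
    clear nd hall hlen hba
    induction C generalizing a with
    | nil => exact absurd rfl s.ne_nil
    | cons c M ih =>
      by_cases hMn : M = []
      · subst hMn
        obtain ⟨rfl, rfl⟩ := s.single_inv
        exact ⟨.nil, rfl⟩
      · obtain ⟨rfl, d, h1, h2⟩ := s.cons_inv hMn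
        obtain ⟨p, hp⟩ := ih _ h2
        exact ⟨.cons h1 p, by simp [hp]⟩
  obtain ⟨p, hp⟩ := hw
  have hpl : p.length + 1 = Fintype.card V := by
    rw [← hlen, ← hp, p.length_support]
  refine ⟨b, .cons hba p, ?_⟩
  rw [SimpleGraph.Walk.isHamiltonianCycle_iff_isCycle_and_length_eq]
  refine ⟨?_, by simpa using hpl⟩
  rw [SimpleGraph.Walk.isCycle_iff_isPath_tail_and_le_length]
  refine ⟨?_, by simp; omega⟩
  rw [SimpleGraph.Walk.isPath_def]
  simp [hp, nd]

end Final

/-- Every 2-connected, claw-heavy, almost distance-hereditary graph on at least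
three vertices is Hamiltonian. -/
theorem hamiltonian_of_clawHeavy_adh {V : Type*} [Fintype V] [DecidableEq V] (G : SimpleGraph V)
    (h3 : 3 ≤ Fintype.card V)
    (h2conn : ∀ v : V, (G.induce {v}ᶜ).Connected)
    (hch : ClawHeavy G) (hadh : AlmostDH G) :
    G.IsHamiltonian := by
  obtain ⟨a, b, c, hab, hac, hbc⟩ := (Fintype.two_lt_card_iff (α := V)).1 h3
  obtain ⟨p⟩ := (h2conn c).preconnected ⟨a, hac⟩ ⟨b, hbc⟩
  have hn : ¬ p.Nil := by
    intro h
    exact hab (congrArg Subtype.val h.eq)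
  have h0 : G.Adj a (p.snd : V) := p.adj_snd hn
  obtain ⟨C, nd, hcyc, h2, hmx⟩ := exists_cycle G h0
  exact ham_of_cyc h3 nd hcyc (maxCyc_spans h2conn hch hadh ⟨nd, hcyc, hmx⟩ h2)
end

section
/- Every 2-connected, 2-heavy, almost distance-hereditary graph on at least 3 vertices is Hamiltonian. -/
open SimpleGraph

/-- `l` is a chain for `K` that starts in `x` and ends in `y`. -/
def Pth {V : Type*} (K : SimpleGraph V) (l : List V) (x y : V) : Prop :=
  l.IsChain K.Adj ∧ l.head? = some x ∧ l.getLast? = some y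

lemma Pth.single {V : Type*} (K : SimpleGraph V) (x : V) : Pth K [x] x x := by
  simp [Pth]

lemma Pth.append {V : Type*} {K : SimpleGraph V} {l l' : List V} {x y z w : V}
    (h : Pth K l x y) (e : K.Adj y z) (h' : Pth K l' z w) : Pth K (l ++ l') x w := by
  obtain ⟨h1, h2, h3⟩ := h
  obtain ⟨h1', h2', h3'⟩ := h'
  refine ⟨?_, ?_, ?_⟩
  · rw [List.isChain_append]
    refine ⟨h1, h1', ?_⟩
    intro a ha b hb
    rw [h3] at ha; rw [h2'] at hb
    simp at ha hb; subst ha; subst hb; exact e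
  · simp [List.head?_append, h2]
  · simp [List.getLast?_append, h3']

lemma Pth.reverse {V : Type*} {K : SimpleGraph V} {l : List V} {x y : V}
    (h : Pth K l x y) : Pth K l.reverse y x := by
  obtain ⟨h1, h2, h3⟩ := h
  refine ⟨?_, ?_, ?_⟩
  · rw [List.isChain_reverse]
    exact h1.imp (fun a b hab => hab.symm)
  · simpa using h3
  · simpa using h2

lemma Pth.mono {V : Type*} {G K : SimpleGraph V} (hle : G ≤ K) {l : List V} {x y : V}
    (h : Pth G l x y) : Pth K l x y := ⟨h.1.imp (fun _ _ hab => hle hab), h.2⟩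

/-- The list `f i, f (i+1), ..., f j`. -/
def sg {V : Type*} (f : ℤ → V) (i j : ℤ) : List V :=
  (List.range (j + 1 - i).toNat).map (fun k : ℕ => f (i + (k : ℤ)))

@[simp] lemma sg_length {V : Type*} (f : ℤ → V) (i j : ℤ) :
    (sg f i j).length = (j + 1 - i).toNat := by simp [sg]

lemma mem_sg {V : Type*} {f : ℤ → V} {i j : ℤ} {x : V} :
    x ∈ sg f i j ↔ ∃ k, i ≤ k ∧ k ≤ j ∧ f k = x := by
  simp only [sg, List.mem_map, List.mem_range]
  constructor
  · rintro ⟨k, hk, rfl⟩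
    exact ⟨i + k, by omega, by omega, rfl⟩
  · rintro ⟨k, h1, h2, rfl⟩
    exact ⟨(k - i).toNat, by omega, by congr 1; omega⟩

lemma sg_pth {V : Type*} {K : SimpleGraph V} {f : ℤ → V} {i j : ℤ} (h : i ≤ j)
    (ha : ∀ k, i ≤ k → k < j → K.Adj (f k) (f (k + 1))) : Pth K (sg f i j) (f i) (f j) := by
  refine ⟨?_, ?_, ?_⟩
  · rw [List.isChain_iff_getElem]
    intro k hk
    simp only [sg_length] at hk
    have := ha (i + k) (by omega) (by omega)
    simpa [sg, add_assoc] using this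
  · have : (j + 1 - i).toNat = (j - i).toNat + 1 := by omega
    simp [sg, this, List.range_succ_eq_map]
  · have : (j + 1 - i).toNat = (j - i).toNat + 1 := by omega
    simp only [sg, this, List.range_succ, List.map_append, List.map_cons, List.map_nil,
      List.getLast?_append, List.getLast?_singleton]
    simp
    congr 1; omega

lemma sg_nodup {V : Type*} {f : ℤ → V} {m : ℕ} {i j : ℤ}
    (inj : ∀ i j : ℤ, i < j → j < i + (m : ℤ) → f i ≠ f j) (h : j < i + m) : (sg f i j).Nodup := by
  rw [sg, List.nodup_map_iff_inj_on List.nodup_range]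
  intro a ha b hb hab
  simp only [List.mem_range] at ha hb
  by_contra hne
  rcases lt_or_gt_of_ne hne with hl | hl
  · exact inj (i + a) (i + b) (by omega) (by omega) hab
  · exact inj (i + b) (i + a) (by omega) (by omega) hab.symm

lemma sg_disj {V : Type*} {f : ℤ → V} {m : ℕ} {i j k l : ℤ}
    (inj : ∀ i j : ℤ, i < j → j < i + (m : ℤ) → f i ≠ f j) (h : j < k) (h' : l < i + m) :
    List.Disjoint (sg f i j) (sg f k l) := by
  intro x hx hy
  rw [mem_sg] at hx hy
  obtain ⟨a, h1, h2, rfl⟩ := hx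
  obtain ⟨b, h3, h4, h5⟩ := hy
  exact inj a b (by omega) (by omega) h5.symm

lemma sg_disj' {V : Type*} {f : ℤ → V} {m : ℕ} {i j k l : ℤ}
    (inj : ∀ i j : ℤ, i < j → j < i + (m : ℤ) → f i ≠ f j) (h : j < k) (h' : l < i + m) :
    List.Disjoint (sg f k l) (sg f i j) := (sg_disj inj h h').symm

lemma sg_one {V : Type*} (f : ℤ → V) (i : ℤ) : sg f i i = [f i] := by
  simp [sg]

/-- `f` is a cyclic (periodic) enumeration of a cycle of length `m` in `F`. -/
structure Cyc_s4 {V : Type*} (F : SimpleGraph V) (m : ℕ) (f : ℤ → V) : Prop where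
  hm : 3 ≤ m
  per : ∀ i : ℤ, f (i + (m : ℤ)) = f i
  inj : ∀ i j : ℤ, i < j → j < i + (m : ℤ) → f i ≠ f j
  adj : ∀ i : ℤ, F.Adj (f i) (f (i + 1))

lemma Cyc_s4.per_mul {V : Type*} {F : SimpleGraph V} {m : ℕ} {f : ℤ → V} (h : Cyc_s4 F m f)
    (i t : ℤ) : f (i + t * m) = f i := by
  induction t using Int.induction_on with
  | zero => simp
  | succ n ih => rw [← ih, ← h.per (i + n * m)]; congr 1; ring
  | pred n ih => rw [← ih, ← h.per (i + (-n - 1) * m)]; congr 1; ring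

lemma Cyc_s4.shift {V : Type*} {F : SimpleGraph V} {m : ℕ} {f : ℤ → V} (h : Cyc_s4 F m f)
    (i x : ℤ) : ∃ k, i ≤ k ∧ k < i + m ∧ f k = f x ∧ ∃ t, k = x + t * m := by
  have hm := h.hm
  have h0 : (0 : ℤ) < m := by omega
  refine ⟨i + (x - i) % m, ?_, ?_, ?_, -((x - i) / m), ?_⟩
  · have := Int.emod_nonneg (x - i) h0.ne'; omega
  · have := Int.emod_lt_of_pos (x - i) h0; omega
  · have e := Int.emod_add_mul_ediv (x - i) m
    rw [← h.per_mul _ ((x - i) / m)]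
    congr 1; linarith
  · have e := Int.emod_add_mul_ediv (x - i) m
    linarith

lemma Cyc_s4.eq_mod {V : Type*} {F : SimpleGraph V} {m : ℕ} {f : ℤ → V} (h : Cyc_s4 F m f)
    {i j : ℤ} (e : f i = f j) : ∃ t, j = i + t * m := by
  obtain ⟨k, h1, h2, h3, t, h4⟩ := h.shift i j
  rcases eq_or_lt_of_le h1 with h5 | h5
  · exact ⟨-t, by rw [h5, h4]; ring⟩
  · exact absurd (e.trans h3.symm) (h.inj i k h5 h2)

lemma Cyc_s4.eq_add {V : Type*} {F : SimpleGraph V} {m : ℕ} {f : ℤ → V} (h : Cyc_s4 F m f)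
    {i j : ℤ} (e : f i = f j) (d : ℤ) : f (i + d) = f (j + d) := by
  obtain ⟨t, rfl⟩ := h.eq_mod e
  rw [show i + t * m + d = i + d + t * m by ring, h.per_mul]

lemma Cyc_s4.mono {V : Type*} {F K : SimpleGraph V} (hle : F ≤ K) {m : ℕ} {f : ℤ → V}
    (h : Cyc_s4 F m f) : Cyc_s4 K m f := ⟨h.hm, h.per, h.inj, fun i => hle (h.adj i)⟩

lemma Cyc_s4.sg_pth {V : Type*} {F : SimpleGraph V} {m : ℕ} {f : ℤ → V} (h : Cyc_s4 F m f)
    {i j : ℤ} (hij : i ≤ j) : Pth F (sg f i j) (f i) (f j) :=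
  _root_.sg_pth hij (fun k _ _ => h.adj k)

/-- predecessor map -/
lemma Cyc_s4.pred {V : Type*} {F : SimpleGraph V} {m : ℕ} {f : ℤ → V} (h : Cyc_s4 F m f) (d : ℤ) :
    ∃ φ : V → V, Function.Injective φ ∧ (∀ k, φ (f k) = f (k + d)) ∧
      ∀ z, (∀ k, f k ≠ z) → φ z = z := by
  classical
  have h1 : ∀ k, (fun z => if h : ∃ k, f k = z then f (h.choose + d) else z) (f k) = f (k + d) := by
    intro k
    have hk : ∃ k', f k' = f k := ⟨k, rfl⟩
    simp only [hk, dite_true]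
    exact h.eq_add hk.choose_spec d
  have h2 : ∀ z, (∀ k, f k ≠ z) →
      (fun z => if h : ∃ k, f k = z then f (h.choose + d) else z) z = z := by
    intro z hz
    have : ¬ ∃ k, f k = z := by simpa using hz
    simp only [this, dite_false]
  refine ⟨fun z => if h : ∃ k, f k = z then f (h.choose + d) else z, ?_, h1, h2⟩
  generalize hφ : (fun z => if h : ∃ k, f k = z then f (h.choose + d) else z) = φ at h1 h2
  intro a b hab
  by_cases ha : ∃ k, f k = a
  · obtain ⟨k, rfl⟩ := ha
    rw [h1] at hab
    by_cases hb : ∃ k, f k = b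
    · obtain ⟨k', rfl⟩ := hb
      rw [h1] at hab
      have := h.eq_add hab (-d)
      simpa using this
    · push Not at hb
      rw [h2 b hb] at hab
      exact absurd hab (hb _)
  · push Not at ha
    rw [h2 a ha] at hab
    by_cases hb : ∃ k, f k = b
    · obtain ⟨k', rfl⟩ := hb
      rw [h1] at hab
      exact absurd hab.symm (ha _)
    · push Not at hb
      rw [h2 b hb] at hab
      exact hab

lemma cyc_of_list {V : Type*} {F : SimpleGraph V} {l : List V} {x y : V} (h : Pth F l x y)
    (e : F.Adj y x) (hn : l.Nodup) (h3 : 3 ≤ l.length) : ∃ f, Cyc_s4 F l.length f := by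
  obtain ⟨hc, hx, hy⟩ := h
  rw [List.isChain_iff_getElem] at hc
  have hlt : ∀ i : ℤ, (i % (l.length : ℤ)).toNat < l.length := by
    intro i
    have h1 := Int.emod_lt_of_pos i (b := (l.length : ℤ)) (by omega)
    have h2 := Int.emod_nonneg i (b := (l.length : ℤ)) (by omega)
    omega
  refine ⟨fun i => l[(i % (l.length : ℤ)).toNat]'(hlt i), h3, ?_, ?_, ?_⟩
  · intro i
    simp
  · intro i j hij hj heq
    rw [hn.getElem_inj_iff] at heq
    have h1 := Int.emod_nonneg i (b := (l.length : ℤ)) (by omega)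
    have h2 := Int.emod_nonneg j (b := (l.length : ℤ)) (by omega)
    have h3 : i % (l.length : ℤ) = j % (l.length : ℤ) := by omega
    have h5 : (l.length : ℤ) ∣ j - i := Int.ModEq.dvd h3
    obtain ⟨t, ht⟩ := h5
    have : 0 < t := by
      by_contra hcon
      nlinarith
    nlinarith
  · intro i
    have h1 := Int.emod_lt_of_pos i (b := (l.length : ℤ)) (by omega)
    have h2 := Int.emod_nonneg i (b := (l.length : ℤ)) (by omega)
    by_cases hc1 : (i % (l.length : ℤ)) + 1 < l.length
    · have e1 : (i + 1) % (l.length : ℤ) = i % (l.length : ℤ) + 1 := by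
        rw [← Int.emod_add_emod]
        exact Int.emod_eq_of_lt (by omega) hc1
      have e2 : ((i + 1) % (l.length : ℤ)).toNat = (i % (l.length : ℤ)).toNat + 1 := by omega
      have := hc (i % (l.length : ℤ)).toNat (by omega)
      simpa only [e2] using this
    · have e1 : (i + 1) % (l.length : ℤ) = 0 := by
        rw [← Int.emod_add_emod]
        rw [show (i % (l.length : ℤ)) + 1 = l.length by omega]
        simp
      have e2 : (i % (l.length : ℤ)).toNat = l.length - 1 := by omega
      simp only [e1, e2]
      have hl : l ≠ [] := by rintro rfl; simp at h3
      have a1 : l[l.length - 1] = y := by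
        rw [List.getLast?_eq_getLast_of_ne_nil hl, List.getLast_eq_getElem] at hy
        simpa using hy
      have a2 : l[0] = x := by
        rw [List.head?_eq_getElem?, List.getElem?_eq_getElem (by omega)] at hx
        simpa using hx
      simpa [a1, a2] using e

lemma ore_exchange {V : Type*} [Fintype V] {G F0 F : SimpleGraph V} (hG : G ≤ F0) {x y : V}
    (hF : ∀ a b, F.Adj a b → F0.Adj a b ∨
      (Heavy G a ∧ Heavy G b ∧ ((a = x ∧ b = y) ∨ (a = y ∧ b = x))))
    {m : ℕ} {f : ℤ → V} (h : Cyc_s4 F m f) : ∃ m' f', m ≤ m' ∧ Cyc_s4 F0 m' f' := by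
  classical
  by_cases hall : ∀ i, F0.Adj (f i) (f (i + 1))
  · exact ⟨m, f, le_rfl, h.hm, h.per, h.inj, hall⟩
  push Not at hall
  obtain ⟨i, hi⟩ := hall
  have hm := h.hm
  rcases hF _ _ (h.adj i) with h' | ⟨hv1, hv2, hxy⟩
  · exact absurd h' hi
  have hadj : ∀ k, i < k → k < i + m → F0.Adj (f k) (f (k + 1)) := by
    intro k hk1 hk2
    rcases hF _ _ (h.adj k) with h' | ⟨_, _, hxy'⟩
    · exact h'
    exfalso
    have hne := h.inj i k hk1 hk2
    have hne2 : f (i + 1) ≠ f (k + 1) := h.inj _ _ (by omega) (by omega)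
    have hsw : f k = f (i + 1) ∧ f (k + 1) = f i := by
      rcases hxy with ⟨a1, a2⟩ | ⟨a1, a2⟩ <;> rcases hxy' with ⟨b1, b2⟩ | ⟨b1, b2⟩ <;>
        simp_all
    have hk : k = i + 1 := by
      by_contra hc
      exact h.inj (i + 1) k (by omega) (by omega) hsw.1.symm
    subst hk
    exact h.inj i (i + 1 + 1) (by omega) (by omega) hsw.2.symm
  have hp : ∀ a b, i < a → a ≤ b → b ≤ i + m → Pth F0 (sg f a b) (f a) (f b) := by
    intro a b h1 h2 h3
    exact sg_pth h2 (fun k hk1 hk2 => hadj k (by omega) (by omega))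
  have hend : f (i + m) = f i := h.per i
  by_cases ha : ∃ z, (∀ k, f k ≠ z) ∧ F0.Adj z (f (i + 1)) ∧ F0.Adj (f i) z
  · obtain ⟨z, hz, z1, z2⟩ := ha
    have p := (hp (i + 1) (i + m) (by omega) (by omega) le_rfl).append (z := z)
      (by rw [hend]; exact z2) (Pth.single _ z)
    obtain ⟨f', hf'⟩ := cyc_of_list p z1 (by
      rw [List.nodup_append']
      refine ⟨sg_nodup h.inj (by omega), by simp, ?_⟩
      simp only [List.disjoint_singleton, mem_sg, not_exists]
      rintro k ⟨_, _, hk⟩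
      exact hz k hk) (by simp; omega)
    exact ⟨_, f', by simp, hf'⟩
  by_cases hb : ∃ k, i < k ∧ k < i + m ∧ F0.Adj (f (i + 1)) (f (k + 1)) ∧ F0.Adj (f i) (f k)
  · obtain ⟨k, hk1, hk2, e1, e2⟩ := hb
    have p := (hp (k + 1) (i + m) (by omega) (by omega) le_rfl).append
      (by rw [hend]; exact e2) (hp (i + 1) k (by omega) (by omega) (by omega)).reverse
    obtain ⟨f', hf'⟩ := cyc_of_list p e1 (by
      rw [List.nodup_append']
      refine ⟨sg_nodup h.inj (by omega), ?_, ?_⟩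
      · rw [List.nodup_reverse]; exact sg_nodup h.inj (by omega)
      · rw [List.disjoint_reverse_right]
        exact sg_disj' h.inj (by omega) (by omega)) (by simp; omega)
    exact ⟨_, f', by simp; omega, hf'⟩
  exfalso
  push Not at ha hb
  obtain ⟨φ, hφ, hφ1, hφ2⟩ := h.pred (-1)
  have hdis : Disjoint (φ '' (G.neighborSet (f (i + 1)))) (insert (f i) (G.neighborSet (f i))) := by
    rw [Set.disjoint_left]
    rintro _ ⟨z, hz, rfl⟩ hz2
    rw [mem_neighborSet] at hz
    by_cases hzc : ∃ k, f k = z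
    · obtain ⟨k0, rfl⟩ := hzc
      obtain ⟨k, hk1, hk2, hk3, -⟩ := h.shift (i + 1) k0
      rw [← hk3] at hz hz2
      rw [hφ1] at hz2
      have hk : k ≠ i + 1 := by
        rintro rfl
        exact G.loopless.irrefl _ hz
      rcases hz2 with hz2 | hz2
      · exact h.inj i (k + -1) (by omega) (by omega) hz2.symm
      · exact hb (k + -1) (by omega) (by omega) (by simpa using hG hz) (hG hz2)
    · push Not at hzc
      rw [hφ2 z hzc] at hz2
      rcases hz2 with hz2 | hz2
      · exact hzc i hz2.symm
      · exact ha z hzc (hG hz.symm) (hG hz2)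
  have hc := Set.ncard_union_eq hdis (Set.toFinite _) (Set.toFinite _)
  rw [Set.ncard_image_of_injective _ hφ,
    Set.ncard_insert_of_notMem (by simp) (Set.toFinite _)] at hc
  have hle := Set.ncard_le_card (φ '' (G.neighborSet (f (i + 1))) ∪
    (insert (f i) (G.neighborSet (f i))))
  rw [Nat.card_eq_fintype_card] at hle
  unfold Heavy at hv1 hv2
  omega

/-- `G` with all edges between heavy vertices added. -/
def KG {V : Type*} [Fintype V] (G : SimpleGraph V) : SimpleGraph V where
  Adj a b := a ≠ b ∧ (G.Adj a b ∨ (Heavy G a ∧ Heavy G b))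
  symm := ⟨fun _ _ h => ⟨h.1.symm, h.2.imp (fun e => e.symm) (fun e => ⟨e.2, e.1⟩)⟩⟩
  loopless := ⟨fun _ h => h.1 rfl⟩

/-- `G` with some of the edges between heavy vertices added. -/
def KS {V : Type*} [Fintype V] (G : SimpleGraph V) (s : Finset (V × V)) : SimpleGraph V where
  Adj a b := a ≠ b ∧ (G.Adj a b ∨ (Heavy G a ∧ Heavy G b ∧ ((a, b) ∈ s ∨ (b, a) ∈ s)))
  symm := ⟨fun _ _ h => ⟨h.1.symm, h.2.imp (fun e => e.symm) (fun e => ⟨e.2.1, e.1, e.2.2.symm⟩)⟩⟩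
  loopless := ⟨fun _ h => h.1 rfl⟩

lemma ore_all {V : Type*} [Fintype V] {G : SimpleGraph V} (s : Finset (V × V)) :
    ∀ {m : ℕ} {f : ℤ → V}, Cyc_s4 (KS G s) m f → ∃ m' f', m ≤ m' ∧ Cyc_s4 G m' f' := by
  classical
  induction s using Finset.induction_on with
  | empty =>
    intro m f h
    refine ⟨m, f, le_rfl, h.mono ?_⟩
    intro a b hab
    simpa using hab.2
  | insert p s hp ih =>
    intro m f h
    obtain ⟨x, y⟩ := p
    obtain ⟨m1, f1, h1, h2⟩ := ore_exchange (G := G) (F0 := KS G s) (x := x) (y := y)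
      (fun a b hab => ⟨hab.ne, Or.inl hab⟩) (by
        rintro a b ⟨hne, hab⟩
        rcases hab with hab | ⟨ha, hb, hab⟩
        · exact Or.inl ⟨hne, Or.inl hab⟩
        · simp only [Finset.mem_insert, Prod.mk.injEq] at hab
          rcases hab with (hab | hab) | (hab | hab)
          · exact Or.inr ⟨ha, hb, Or.inl hab⟩
          · exact Or.inl ⟨hne, Or.inr ⟨ha, hb, Or.inl hab⟩⟩
          · exact Or.inr ⟨ha, hb, Or.inr ⟨hab.2, hab.1⟩⟩
          · exact Or.inl ⟨hne, Or.inr ⟨ha, hb, Or.inr hab⟩⟩) h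
    obtain ⟨m2, f2, h3, h4⟩ := ih h2
    exact ⟨m2, f2, h1.trans h3, h4⟩

lemma le_KG {V : Type*} [Fintype V] (G : SimpleGraph V) : G ≤ KG G :=
  fun _ _ hab => ⟨hab.ne, Or.inl hab⟩

lemma ore_K {V : Type*} [Fintype V] {G : SimpleGraph V} {m : ℕ} {f : ℤ → V}
    (h : Cyc_s4 (KG G) m f) : ∃ m' f', m ≤ m' ∧ Cyc_s4 G m' f' := by
  apply ore_all Finset.univ (m := m) (f := f)
  apply h.mono
  intro a b hab
  exact ⟨hab.1, hab.2.imp id (fun e => ⟨e.1, e.2, by simp⟩)⟩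

lemma Cyc_s4.le_card {V : Type*} [Fintype V] {G : SimpleGraph V} {m : ℕ} {f : ℤ → V}
    (h : Cyc_s4 G m f) : m ≤ Fintype.card V := by
  have h1 : (sg f 1 m).Nodup := sg_nodup h.inj (by omega)
  have := h1.length_le_card
  simp at this
  omega

lemma exists_max_cyc {V : Type*} [Fintype V] {G : SimpleGraph V} {m : ℕ} {f : ℤ → V}
    (h : Cyc_s4 G m f) : ∃ m f, Cyc_s4 G m f ∧ ∀ l x y, Pth (KG G) l x y → (KG G).Adj y x →
      l.Nodup → l.length ≤ m := by
  classical
  have hex : ∃ m, (∃ f, Cyc_s4 (KG G) m f) ∧ ∀ m', (∃ f, Cyc_s4 (KG G) m' f) → m' ≤ m := by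
    have hP : ∃ f, Cyc_s4 (KG G) m f := ⟨f, h.mono (le_KG G)⟩
    refine ⟨Nat.findGreatest (fun m => ∃ f, Cyc_s4 (KG G) m f) (Fintype.card V), ?_, ?_⟩
    · exact Nat.findGreatest_spec (P := fun m => ∃ f, Cyc_s4 (KG G) m f) h.le_card hP
    · rintro m' ⟨f', hf'⟩
      exact Nat.le_findGreatest hf'.le_card ⟨f', hf'⟩
  obtain ⟨m1, ⟨f1, hf1⟩, hmax⟩ := hex
  obtain ⟨m2, f2, hle, hf2⟩ := ore_K hf1
  refine ⟨m2, f2, hf2, ?_⟩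
  intro l x y hp e hn
  by_cases h3 : 3 ≤ l.length
  · exact (hmax _ (cyc_of_list hp e hn h3)).trans hle
  · have := hf2.hm
    omega

/-- reachability by a walk inside `H` -/
def RC {V : Type*} (G : SimpleGraph V) (H : Set V) (x y : V) : Prop :=
  Relation.ReflTransGen (fun a b => a ∈ H ∧ b ∈ H ∧ G.Adj a b) x y

lemma RC.mono {V : Type*} {G : SimpleGraph V} {H H' : Set V} (hle : H ⊆ H') {x y : V}
    (h : RC G H x y) : RC G H' x y :=
  Relation.ReflTransGen.mono (fun _ _ h => ⟨hle h.1, hle h.2.1, h.2.2⟩) _ _ h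

lemma RC.symm {V : Type*} {G : SimpleGraph V} {H : Set V} {x y : V}
    (h : RC G H x y) : RC G H y x := by
  induction h with
  | refl => exact Relation.ReflTransGen.refl
  | tail _ h ih => exact Relation.ReflTransGen.head ⟨h.2.1, h.1, h.2.2.symm⟩ ih

lemma RC.trans {V : Type*} {G : SimpleGraph V} {H : Set V} {x y z : V}
    (h : RC G H x y) (h' : RC G H y z) : RC G H x z := Relation.ReflTransGen.trans h h'

lemma RC.edge {V : Type*} {G : SimpleGraph V} {H : Set V} {x y : V}
    (hx : x ∈ H) (hy : y ∈ H) (h : G.Adj x y) : RC G H x y :=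
  Relation.ReflTransGen.single ⟨hx, hy, h⟩

lemma RC.reachable {V : Type*} {G : SimpleGraph V} {H : Set V} {x y : V} (hx : x ∈ H)
    (h : RC G H x y) : ∃ hy : y ∈ H, (G.induce H).Reachable ⟨x, hx⟩ ⟨y, hy⟩ := by
  induction h with
  | refl => exact ⟨hx, Reachable.refl _⟩
  | tail _ h ih =>
    obtain ⟨hb, hr⟩ := ih
    refine ⟨h.2.1, hr.trans ?_⟩
    apply Adj.reachable
    exact h.2.2

lemma RC.of_reachable {V : Type*} {G : SimpleGraph V} {H : Set V} {x y : H}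
    (h : (G.induce H).Reachable x y) : RC G H x y := by
  obtain ⟨p⟩ := h
  induction p with
  | nil => exact Relation.ReflTransGen.refl
  | cons e _ ih => exact Relation.ReflTransGen.head ⟨Subtype.property _, Subtype.property _, e⟩ ih

lemma RC.path {V : Type*} {G : SimpleGraph V} {H : Set V} {x y : V} (hx : x ∈ H)
    (h : RC G H x y) : ∃ l, Pth G l x y ∧ l.Nodup ∧ ∀ z ∈ l, z ∈ H := by
  classical
  obtain ⟨hy, hr⟩ := h.reachable hx
  obtain ⟨p, hp⟩ := hr.exists_isPath
  refine ⟨p.support.map Subtype.val, ⟨?_, ?_, ?_⟩, ?_, ?_⟩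
  · rw [List.isChain_map]
    exact p.isChain_adj_support.imp (fun _ _ h => h)
  · rw [List.head?_map, List.head?_eq_some_head p.support_ne_nil]
    simp
  · rw [List.getLast?_map, List.getLast?_eq_getLast_of_ne_nil p.support_ne_nil]
    simp
  · exact hp.support_nodup.map Subtype.val_injective
  · intro z hz
    rw [List.mem_map] at hz
    obtain ⟨a, _, rfl⟩ := hz
    exact a.2

lemma connected_of_RC {V : Type*} {G : SimpleGraph V} {H : Set V} {x : V} (hx : x ∈ H)
    (h : ∀ y ∈ H, RC G H x y) : (G.induce H).Connected := by
  have : Nonempty H := ⟨⟨x, hx⟩⟩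
  refine ⟨fun a b => ?_⟩
  obtain ⟨ha, hra⟩ := (h a a.2).reachable hx
  obtain ⟨hb, hrb⟩ := (h b b.2).reachable hx
  exact hra.symm.trans hrb

lemma adh3 {V : Type*} {G : SimpleGraph V} (hadh : AlmostDH G) {H : Set V} {x y z : V}
    (hx : x ∈ H) (h : ∀ y ∈ H, RC G H x y) (hy : y ∈ H) (h1 : G.Adj z x) (h2 : G.Adj z y) :
    x = y ∨ G.Adj x y ∨ (∃ p ∈ H, G.Adj x p ∧ G.Adj p y) ∨
      ∃ p ∈ H, ∃ q ∈ H, G.Adj x p ∧ G.Adj p q ∧ G.Adj q y := by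
  have hc := connected_of_RC hx h
  have hd := hadh H hc ⟨x, hx⟩ ⟨y, hy⟩
  have h2' : G.dist x y ≤ 2 := by
    have := dist_le (Walk.cons h1.symm (Walk.cons h2 Walk.nil))
    simpa using this
  obtain ⟨p, hp⟩ := hc.exists_walk_length_eq_dist ⟨x, hx⟩ ⟨y, hy⟩
  have hl : p.length ≤ 3 := by rw [hp]; exact hd.trans (Nat.succ_le_succ h2')
  clear hp hd
  match p, hl with
  | .nil, _ => left; rfl
  | .cons e .nil, _ => right; left; exact e
  | .cons (v := a) e (.cons e' .nil), _ => right; right; left; exact ⟨a, a.2, e, e'⟩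
  | .cons (v := a) e (.cons (v := b) e' (.cons e'' .nil)), _ =>
    right; right; right; exact ⟨a, a.2, b, b.2, e, e', e''⟩
  | .cons e (.cons e' (.cons e'' (.cons e3 q))), hl => simp at hl; omega

lemma exists_nbr {V : Type*} [Fintype V] [DecidableEq V] (G : SimpleGraph V)
    (h3 : 3 ≤ Fintype.card V) (h2conn : ∀ v : V, (G.induce {v}ᶜ).Connected) {v x : V}
    (hvx : v ≠ x) : ∃ a, a ≠ x ∧ G.Adj v a := by
  obtain ⟨w, hw⟩ : ∃ w, w ∉ ({v, x} : Finset V) := by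
    by_contra hcon
    push Not at hcon
    have h := Finset.card_le_card (s := Finset.univ) (t := {v, x}) (fun z _ => hcon z)
    have h' := Finset.card_le_two (a := v) (b := x)
    rw [Finset.card_univ] at h
    omega
  simp only [Finset.mem_insert, Finset.mem_singleton, not_or] at hw
  have hr : RC G {x}ᶜ v w := RC.of_reachable (x := ⟨v, hvx⟩) (y := ⟨w, hw.2⟩)
    ((h2conn x).preconnected _ _)
  rcases Relation.ReflTransGen.cases_head hr with h | ⟨c, ⟨h1, h2, h3⟩, _⟩
  · exact absurd h.symm hw.1
  · exact ⟨c, h2, h3⟩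

lemma exists_cyc {V : Type*} [Fintype V] [DecidableEq V] (G : SimpleGraph V)
    (h3 : 3 ≤ Fintype.card V) (h2conn : ∀ v : V, (G.induce {v}ᶜ).Connected) :
    ∃ m f, Cyc_s4 G m f := by
  have : Nontrivial V := Fintype.one_lt_card_iff_nontrivial.mp (by omega)
  obtain ⟨v, x, hvx⟩ := exists_pair_ne V
  obtain ⟨a, _, hva⟩ := exists_nbr G h3 h2conn hvx
  obtain ⟨b, hba, hvb⟩ := exists_nbr G h3 h2conn hva.ne
  have hr : RC G {v}ᶜ a b := RC.of_reachable (x := ⟨a, hva.ne'⟩) (y := ⟨b, hvb.ne'⟩)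
    ((h2conn v).preconnected _ _)
  obtain ⟨l, hl, hn, hv⟩ := hr.path hva.ne'
  have p := (Pth.single G v).append hva hl
  obtain ⟨f, hf⟩ := cyc_of_list p hvb.symm (by
    simp only [List.singleton_append, List.nodup_cons]
    exact ⟨fun h => hv v h rfl, hn⟩) (by
    obtain ⟨_, h1, h2⟩ := hl
    match l with
    | [] => simp at h1
    | [c] => simp at h1 h2; exact absurd (h2.symm.trans h1) hba
    | c :: d :: l' => simp)
  exact ⟨_, f, hf⟩

lemma path_edge_len {V : Type*} {G : SimpleGraph V} {x y : V} (hadj : G.Adj y x)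
    (w : G.Walk x y) (hwp : w.IsPath) (he : s(y, x) ∈ w.edges) : w.length = 1 := by
  cases w with
  | nil => exact absurd rfl hadj.ne
  | cons e q =>
    rw [Walk.cons_isPath_iff] at hwp
    simp only [Walk.edges_cons, List.mem_cons] at he
    rcases he with he | he
    · rw [Sym2.eq_iff] at he
      rcases he with he | he
      · exact absurd he.1.symm hadj.ne'
      · have hv := he.1
        subst hv
        have := Walk.isPath_iff_nil.mp hwp.1
        simp [Walk.length_eq_zero_iff.mpr this]
    · exact absurd (Walk.snd_mem_support_of_mem_edges q he) hwp.2

lemma ham_of_cover {V : Type*} [Fintype V] [DecidableEq V] {G : SimpleGraph V}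
    {m : ℕ} {f : ℤ → V} (h : Cyc_s4 G m f) (hcov : ∀ v, ∃ k, f k = v) : G.IsHamiltonian := by
  have hm := h.hm
  intro _
  have hp := h.sg_pth (i := 1) (j := m) (by omega)
  have hn : (sg f 1 m).Nodup := sg_nodup h.inj (by omega)
  have hne : sg f 1 m ≠ [] := by
    intro h0
    have := congrArg List.length h0
    simp at this
    omega
  have hlen : (sg f 1 m).length = m := by simp
  have hx : (sg f 1 m).head hne = f 1 := by
    have := hp.2.1
    rw [List.head?_eq_some_head hne] at this
    simpa using this
  have hy : (sg f 1 m).getLast hne = f m := by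
    have := hp.2.2
    rw [List.getLast?_eq_getLast_of_ne_nil hne] at this
    simpa using this
  obtain ⟨w, hw⟩ : ∃ w : G.Walk (f 1) (f m), w.support = sg f 1 m := by
    refine ⟨(Walk.ofSupport _ hne hp.1).copy hx hy, ?_⟩
    simp
  have hwp : w.IsPath := by
    rw [Walk.isPath_def, hw]; exact hn
  have hadj : G.Adj (f m) (f 1) := by
    have := h.adj m
    rw [add_comm, h.per] at this
    exact this
  have hwl : w.length + 1 = m := by
    rw [← Walk.length_support, hw, hlen]
  refine ⟨f m, Walk.cons hadj w, ?_⟩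
  rw [Walk.isHamiltonianCycle_iff_isCycle_and_length_eq]
  have hcard : Fintype.card V = m := by
    apply le_antisymm _ h.le_card
    have : Finset.univ ⊆ (sg f 1 m).toFinset := by
      intro v _
      obtain ⟨k, rfl⟩ := hcov v
      obtain ⟨k', h1, h2, h3, -⟩ := h.shift 1 k
      rw [List.mem_toFinset, mem_sg]
      exact ⟨k', h1, by omega, h3⟩
    calc Fintype.card V = Finset.univ.card := rfl
      _ ≤ _ := Finset.card_le_card this
      _ ≤ _ := List.toFinset_card_le _
      _ = m := hlen
  constructor
  · rw [Walk.cons_isCycle_iff]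
    refine ⟨hwp, ?_⟩
    intro he
    have hw1 : w.length = 1 := by exact path_edge_len hadj w hwp he
    omega
  · simp [hwl, hcard]

/-- The situation of the proof: a cycle `f` of `G`, at least as long as every cycle of `KG G`,
together with a component `R` of the rest. -/
structure Big {V : Type*} [Fintype V] (G : SimpleGraph V) (m : ℕ) (f : ℤ → V) (R : Set V) :
    Prop where
  cyc : Cyc_s4 G m f
  max : ∀ l x y, Pth (KG G) l x y → (KG G).Adj y x → l.Nodup → l.length ≤ m
  tw : TwoHeavy G
  adh : AlmostDH G
  out : ∀ r ∈ R, ∀ k, f k ≠ r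
  conn : ∀ r ∈ R, ∀ s ∈ R, RC G R r s
  cl : ∀ r ∈ R, ∀ s, G.Adj r s → (∀ k, f k ≠ s) → s ∈ R
  two : ∀ i, ∃ j, f j ≠ f i ∧ ∃ r ∈ R, G.Adj r (f j)

/-- The vertex `v` has a neighbour in `R`. -/
def At {V : Type*} (G : SimpleGraph V) (R : Set V) (v : V) : Prop := ∃ r ∈ R, G.Adj r v

section big

variable {V : Type*} [Fintype V] {G : SimpleGraph V} {m : ℕ} {f : ℤ → V} {R : Set V}

lemma KG_claw (tw : TwoHeavy G) {a b c d : V} (hb : G.Adj a b) (hc : G.Adj a c) (hd : G.Adj a d)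
    (h1 : b ≠ c) (h2 : b ≠ d) (h3 : c ≠ d) :
    (KG G).Adj b c ∨ (KG G).Adj b d ∨ (KG G).Adj c d := by
  by_cases e1 : G.Adj b c
  · exact Or.inl ⟨h1, Or.inl e1⟩
  by_cases e2 : G.Adj b d
  · exact Or.inr (Or.inl ⟨h2, Or.inl e2⟩)
  by_cases e3 : G.Adj c d
  · exact Or.inr (Or.inr ⟨h3, Or.inl e3⟩)
  rcases tw a b c d ⟨hb, hc, hd, e1, e2, e3, h1, h2, h3⟩ with h | h | h
  · exact Or.inl ⟨h1, Or.inr h⟩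
  · exact Or.inr (Or.inl ⟨h2, Or.inr h⟩)
  · exact Or.inr (Or.inr ⟨h3, Or.inr h⟩)

lemma Big.no_path (B : Big G m f R) {l : List V} {x y r s : V} (hr : r ∈ R) (hs : s ∈ R)
    (hrx : (KG G).Adj r x) (hsy : (KG G).Adj s y) (hl : Pth (KG G) l x y) (hn : l.Nodup)
    (hmem : ∀ z ∈ l, ∃ k, f k = z) (hlen : m ≤ l.length) : False := by
  obtain ⟨P, hP, hPn, hPR⟩ := (B.conn s hs r hr).path hs
  have p := (hP.mono (le_KG G)).append hrx hl
  have h := B.max _ _ _ p hsy.symm (by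
    rw [List.nodup_append']
    refine ⟨hPn, hn, ?_⟩
    intro z hz hz'
    obtain ⟨k, hk⟩ := hmem z hz'
    exact B.out z (hPR z hz) k hk)
  have : P.length ≠ 0 := by
    intro h0
    rw [List.length_eq_zero_iff] at h0
    subst h0
    simp [Pth] at hP
  simp at h
  omega

lemma Big.inj (B : Big G m f R) : ∀ i j : ℤ, i < j → j < i + (m : ℤ) → f i ≠ f j := B.cyc.inj

lemma Big.hm (B : Big G m f R) : 3 ≤ m := B.cyc.hm

lemma Big.sp (B : Big G m f R) {i j : ℤ} (h : i ≤ j) : Pth (KG G) (sg f i j) (f i) (f j) :=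
  (B.cyc.sg_pth h).mono (le_KG G)

lemma At.K {v : V} (h : At G R v) : ∃ r ∈ R, (KG G).Adj r v := by
  obtain ⟨r, hr, e⟩ := h
  exact ⟨r, hr, le_KG G e⟩

lemma At.K' {v r : V} (hr : r ∈ R) (e : G.Adj r v) : At G R v := ⟨r, hr, e⟩

lemma Big.not_succ (B : Big G m f R) {i : ℤ} (h : At G R (f i)) {r : V} (hr : r ∈ R) :
    ¬ (KG G).Adj r (f (i + 1)) := by
  intro e
  obtain ⟨s, hs, e'⟩ := h.K
  have hm := B.hm
  refine B.no_path (l := sg f (i + 1) (i + m)) hr hs e ?_ (B.sp (by omega)) ?_ ?_ ?_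
  · rw [B.cyc.per]; exact e'
  · exact sg_nodup B.inj (by omega)
  · intro z hz
    rw [mem_sg] at hz
    obtain ⟨k, _, _, hk⟩ := hz
    exact ⟨k, hk⟩
  · simp

lemma Big.not_pred (B : Big G m f R) {i : ℤ} (h : At G R (f i)) {r : V} (hr : r ∈ R) :
    ¬ (KG G).Adj r (f (i - 1)) := by
  intro e
  obtain ⟨s, hs, e'⟩ := h.K
  have hm := B.hm
  refine B.no_path (l := sg f i (i + m - 1)) hs hr e' ?_ (B.sp (by omega)) ?_ ?_ ?_
  · rw [show i + (m : ℤ) - 1 = i - 1 + m by ring, B.cyc.per]; exact e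
  · exact sg_nodup B.inj (by omega)
  · intro z hz
    rw [mem_sg] at hz
    obtain ⟨k, _, _, hk⟩ := hz
    exact ⟨k, hk⟩
  · simp

lemma Big.succ_notAt (B : Big G m f R) {i : ℤ} (h : At G R (f i)) : ¬ At G R (f (i + 1)) := by
  intro h'
  obtain ⟨r, hr, e⟩ := h'.K
  exact B.not_succ h hr e

lemma Big.pred_notAt (B : Big G m f R) {i : ℤ} (h : At G R (f i)) : ¬ At G R (f (i - 1)) := by
  intro h'
  obtain ⟨r, hr, e⟩ := h'.K
  exact B.not_pred h hr e

lemma Big.adjp (B : Big G m f R) (i : ℤ) : G.Adj (f i) (f (i - 1)) := by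
  have := B.cyc.adj (i - 1)
  rw [sub_add_cancel] at this
  exact this.symm

lemma Big.pm (B : Big G m f R) {i : ℤ} (h : At G R (f i)) :
    (KG G).Adj (f (i - 1)) (f (i + 1)) := by
  obtain ⟨r, hr, e⟩ := id h
  have hm := B.hm
  rcases KG_claw B.tw e.symm (B.adjp i) (B.cyc.adj i) (B.out r hr _).symm (B.out r hr _).symm
    (B.inj _ _ (by omega) (by omega)) with h1 | h1 | h1
  · exact absurd h1 (B.not_pred h hr)
  · exact absurd h1 (B.not_succ h hr)
  · exact h1

lemma Big.pp (B : Big G m f R) {i j : ℤ} (hi : At G R (f i)) (hj : At G R (f j)) (h1 : i < j)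
    (h2 : j < i + m) : ¬ (KG G).Adj (f (i + 1)) (f (j + 1)) := by
  intro e
  obtain ⟨r, hr, er⟩ := hi.K
  obtain ⟨s, hs, es⟩ := hj.K
  have p := (B.sp (i := i + 1) (j := j) (by omega)).reverse.append e
    (B.sp (i := j + 1) (j := i + m) (by omega))
  refine B.no_path hs hr es (by rw [B.cyc.per]; exact er) p ?_ ?_ ?_
  · simp only [List.nodup_append', List.nodup_reverse, List.disjoint_reverse_left]
    exact ⟨sg_nodup B.inj (by omega), sg_nodup B.inj (by omega),
      sg_disj B.inj (by omega) (by omega)⟩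
  · simp only [List.mem_append, List.mem_reverse, mem_sg]
    grind
  · simp; omega

lemma Big.mm (B : Big G m f R) {i j : ℤ} (hi : At G R (f i)) (hj : At G R (f j)) (h1 : i < j)
    (h2 : j < i + m) : ¬ (KG G).Adj (f (i - 1)) (f (j - 1)) := by
  intro e
  obtain ⟨r, hr, er⟩ := hi.K
  obtain ⟨s, hs, es⟩ := hj.K
  have p := (B.sp (i := j) (j := i + m - 1) (by omega)).append
    (by rw [show i + (m : ℤ) - 1 = i - 1 + m by ring, B.cyc.per]; exact e)
    (B.sp (i := i) (j := j - 1) (by omega)).reverse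
  refine B.no_path hs hr es er p ?_ ?_ ?_
  · simp only [List.nodup_append', List.nodup_reverse, List.disjoint_reverse_right]
    exact ⟨sg_nodup B.inj (by omega), sg_nodup B.inj (by omega),
      sg_disj' B.inj (by omega) (by omega)⟩
  · simp only [List.mem_append, List.mem_reverse, mem_sg]
    grind
  · simp; omega

lemma Big.ps (B : Big G m f R) {i j : ℤ} (hi : At G R (f i)) (hj : At G R (f j)) (h1 : i < j)
    (h2 : j < i + m) : ¬ (KG G).Adj (f (i + 1)) (f j) := by
  intro e
  obtain ⟨r, hr, er⟩ := hi.K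
  obtain ⟨s, hs, es⟩ := hj.K
  have h3 : j ≠ i + 1 := by
    rintro rfl
    exact e.ne rfl
  have p := ((B.sp (le_refl j)).append e.symm (B.sp (i := i + 1) (j := j - 1) (by omega))).append
    (B.pm hj) (B.sp (i := j + 1) (j := i + m) (by omega))
  refine B.no_path hs hr es (by rw [B.cyc.per]; exact er) p ?_ ?_ ?_
  · simp only [List.nodup_append', List.disjoint_append_left]
    exact ⟨⟨sg_nodup B.inj (by omega), sg_nodup B.inj (by omega),
      sg_disj' B.inj (by omega) (by omega)⟩, sg_nodup B.inj (by omega),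
      sg_disj B.inj (by omega) (by omega), sg_disj B.inj (by omega) (by omega)⟩
  · simp only [List.mem_append, List.mem_reverse, mem_sg]
    grind
  · simp; omega

lemma Big.ms (B : Big G m f R) {i j : ℤ} (hi : At G R (f i)) (hj : At G R (f j)) (h1 : i < j)
    (h2 : j < i + m) : ¬ (KG G).Adj (f (i - 1)) (f j) := by
  intro e
  obtain ⟨r, hr, er⟩ := hi.K
  obtain ⟨s, hs, es⟩ := hj.K
  rw [← B.cyc.per, show i - 1 + (m : ℤ) = i + m - 1 by ring] at e
  have h3 : j ≠ i + m - 1 := by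
    rintro rfl
    exact e.ne rfl
  have p := ((B.sp (le_refl j)).append e.symm
    (B.sp (i := j + 1) (j := i + m - 1) (by omega)).reverse).append
    (B.pm hj).symm (B.sp (i := i) (j := j - 1) (by omega)).reverse
  refine B.no_path hs hr es er p ?_ ?_ ?_
  · simp only [List.nodup_append', List.disjoint_append_left, List.nodup_reverse,
      List.disjoint_reverse_left, List.disjoint_reverse_right]
    exact ⟨⟨sg_nodup B.inj (by omega), sg_nodup B.inj (by omega),
      sg_disj B.inj (by omega) (by omega)⟩, sg_nodup B.inj (by omega),
      sg_disj' B.inj (by omega) (by omega), sg_disj' B.inj (by omega) (by omega)⟩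
  · simp only [List.mem_append, List.mem_reverse, mem_sg]
    grind
  · simp; omega

end big

section big2

variable {V : Type*} [Fintype V] {G : SimpleGraph V} {m : ℕ} {f : ℤ → V} {R : Set V}

lemma Big.norm (B : Big G m f R) {i j : ℤ} (h : f i ≠ f j) : ∃ k, i < k ∧ k < i + m ∧
    f k = f j ∧ f (k + 1) = f (j + 1) ∧ f (k - 1) = f (j - 1) := by
  obtain ⟨k, h1, h2, h3, -⟩ := B.cyc.shift i j
  refine ⟨k, ?_, h2, h3, B.cyc.eq_add h3 1, B.cyc.eq_add h3 (-1)⟩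
  rcases eq_or_lt_of_le h1 with h4 | h4
  · subst h4; exact absurd h3 h
  · exact h4

lemma Big.pp' (B : Big G m f R) {i j : ℤ} (hi : At G R (f i)) (hj : At G R (f j))
    (h : f i ≠ f j) : ¬ (KG G).Adj (f (i + 1)) (f (j + 1)) := by
  obtain ⟨k, h1, h2, h3, h4, h5⟩ := B.norm h
  rw [← h4]; rw [← h3] at hj
  exact B.pp hi hj h1 h2

lemma Big.mm' (B : Big G m f R) {i j : ℤ} (hi : At G R (f i)) (hj : At G R (f j))
    (h : f i ≠ f j) : ¬ (KG G).Adj (f (i - 1)) (f (j - 1)) := by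
  obtain ⟨k, h1, h2, h3, h4, h5⟩ := B.norm h
  rw [← h5]; rw [← h3] at hj
  exact B.mm hi hj h1 h2

lemma Big.ps' (B : Big G m f R) {i j : ℤ} (hi : At G R (f i)) (hj : At G R (f j))
    (h : f i ≠ f j) : ¬ (KG G).Adj (f (i + 1)) (f j) := by
  obtain ⟨k, h1, h2, h3, h4, h5⟩ := B.norm h
  rw [← h3]; rw [← h3] at hj
  exact B.ps hi hj h1 h2

lemma Big.ms' (B : Big G m f R) {i j : ℤ} (hi : At G R (f i)) (hj : At G R (f j))
    (h : f i ≠ f j) : ¬ (KG G).Adj (f (i - 1)) (f j) := by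
  obtain ⟨k, h1, h2, h3, h4, h5⟩ := B.norm h
  rw [← h3]; rw [← h3] at hj
  exact B.ms hi hj h1 h2

lemma Big.choose_v1 (B : Big G m f R) : ∃ i, At G R (f i) ∧
    ∀ k, At G R (f k) → f k ≠ f i → G.Adj (f (k - 1)) (f (k + 1)) := by
  by_cases hb : ∃ i, At G R (f i) ∧ ¬ G.Adj (f (i - 1)) (f (i + 1))
  · obtain ⟨i, hi, hn⟩ := hb
    refine ⟨i, hi, ?_⟩
    intro k hk hne
    by_contra hcon
    have h1 := B.pm hi
    have h2 := B.pm hk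
    have h3 := (h1.2.resolve_left hn).2
    have h4 := (h2.2.resolve_left hcon).2
    refine B.pp' hi hk hne.symm ⟨?_, Or.inr ⟨h3, h4⟩⟩
    intro e
    have := B.cyc.eq_add e (-1)
    simp at this
    exact hne this.symm
  · push Not at hb
    obtain ⟨j, _, hj⟩ := B.two 0
    exact ⟨j, hj, fun k hk _ => hb k hk⟩

/-- The chosen pair of consecutive attachment vertices. -/
structure Conf {V : Type*} [Fintype V] (G : SimpleGraph V) (m : ℕ) (f : ℤ → V) (R : Set V)
    (i j : ℤ) : Prop where
  big : Big G m f R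
  hi : At G R (f i)
  hj : At G R (f j)
  hij : i < j
  hji : j < i + m
  gap : ∀ k, i < k → k < j → ¬ At G R (f k)
  unb : ∀ k, At G R (f k) → f k ≠ f i → G.Adj (f (k - 1)) (f (k + 1))

lemma Big.conf (B : Big G m f R) : ∃ i j, Conf G m f R i j := by
  classical
  obtain ⟨i, hi, hu⟩ := B.choose_v1
  obtain ⟨j0, hne, hj0⟩ := B.two i
  obtain ⟨k, h1, h2, h3, -, -⟩ := B.norm hne.symm
  have hex : ∃ n : ℕ, At G R (f (i + 1 + n)) := by
    refine ⟨(k - i - 1).toNat, ?_⟩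
    rw [show i + 1 + ((k - i - 1).toNat : ℤ) = k by omega, h3]
    exact hj0
  have hle : Nat.find hex ≤ (k - i - 1).toNat := by
    apply Nat.find_min'
    rw [show i + 1 + ((k - i - 1).toNat : ℤ) = k by omega, h3]
    exact hj0
  refine ⟨i, i + 1 + (Nat.find hex : ℤ), B, hi, Nat.find_spec hex, by omega, by omega, ?_, hu⟩
  intro t ht1 ht2 hat
  refine Nat.find_min hex (m := (t - i - 1).toNat) (by omega) ?_
  rw [show i + 1 + ((t - i - 1).toNat : ℤ) = t by omega]
  exact hat

lemma Big.RC_sg (B : Big G m f R) {H : Set V} {a b : ℤ} (hab : a ≤ b)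
    (h : ∀ t, a ≤ t → t ≤ b → f t ∈ H) : RC G H (f a) (f b) := by
  induction b, hab using Int.leInduction with
  | base => exact Relation.ReflTransGen.refl
  | succ n hn ih =>
    exact (ih (fun t h1 h2 => h t h1 (by omega))).trans
      (RC.edge (h n hn (by omega)) (h _ (by omega) le_rfl) (B.cyc.adj n))

lemma Conf.hj1 {i j : ℤ} (C : Conf G m f R i j) : i + 1 < j := by
  have := C.hij
  by_contra hc
  have e : j = i + 1 := by omega
  have h := C.hj
  rw [e] at h
  exact C.big.succ_notAt C.hi h

lemma Conf.hj2 {i j : ℤ} (C : Conf G m f R i j) : j + 1 < i + m := by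
  have := C.hji
  by_contra hc
  have e : j = i - 1 + m := by omega
  have h := C.hj
  rw [e, C.big.cyc.per] at h
  exact C.big.pred_notAt C.hi h

lemma Conf.ne {i j : ℤ} (C : Conf G m f R i j) : f i ≠ f j := C.big.inj _ _ C.hij C.hji

/-- The crossing surgery of Step 2. -/
lemma Conf.crossing {i j k : ℤ} (C : Conf G m f R i j) (h1 : i < k) (h2 : k + 1 < j)
    (h3 : G.Adj (f i) (f k)) : ¬ G.Adj (f (k + 1)) (f j) := by
  intro e
  have B := C.big
  have a1 := C.hj1
  have a2 := C.hj2
  obtain ⟨r, hr, er⟩ := C.hi.K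
  obtain ⟨s, hs, es⟩ := C.hj.K
  have hpm := B.pm C.hi
  rw [← B.cyc.per, show i - 1 + (m : ℤ) = i + m - 1 by ring] at hpm
  have p := ((((B.sp (le_refl j)).append (le_KG G e.symm)
    (B.sp (i := k + 1) (j := j - 1) (by omega))).append (B.pm C.hj)
    (B.sp (i := j + 1) (j := i + m - 1) (by omega))).append hpm
    (B.sp (i := i + 1) (j := k) (by omega))).append (le_KG G h3.symm) (B.sp (le_refl i))
  refine B.no_path hs hr es er p ?_ ?_ ?_
  · simp only [List.nodup_append', List.disjoint_append_left]
    refine ⟨⟨⟨⟨?_, ?_, ?_⟩, ?_, ?_, ?_⟩, ?_, ⟨?_, ?_⟩, ?_⟩, ?_, ⟨⟨?_, ?_⟩, ?_⟩, ?_⟩ <;>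
    first
    | exact sg_nodup B.inj (by omega)
    | exact sg_disj B.inj (by omega) (by omega)
    | exact sg_disj' B.inj (by omega) (by omega)
  · simp only [List.mem_append, mem_sg]
    grind
  · simp; omega

lemma Conf.v1v2 {i j : ℤ} (C : Conf G m f R i j) : G.Adj (f i) (f j) := by
  by_contra hno
  have B := C.big
  have a1 := C.hj1
  have a2 := C.hj2
  have hij := C.hij
  obtain ⟨k, ⟨hk1, hk2, hk3⟩, hkmax⟩ : ∃ k, (i < k ∧ k < j ∧ G.Adj (f i) (f k)) ∧
      ∀ t, (i < t ∧ t < j ∧ G.Adj (f i) (f t)) → t ≤ k :=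
    Int.exists_greatest_of_bdd ⟨j, fun z hz => hz.2.1.le⟩
      ⟨i + 1, by omega, by omega, B.cyc.adj i⟩
  have hnb : ∀ t, k < t → t ≤ j → ¬ G.Adj (f i) (f t) := by
    intro t h1 h2 e
    rcases eq_or_lt_of_le h2 with h3 | h3
    · subst h3; exact hno e
    · have := hkmax t ⟨by omega, h3, e⟩
      omega
  have hk4 : k + 1 < j := by
    by_contra hc
    have e : k = j - 1 := by omega
    subst e
    exact B.ms' C.hj C.hi C.ne.symm (le_KG G hk3.symm)
  have hcr := C.crossing hk1 hk4 hk3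
  set H : Set V := {x | (∃ t, k + 1 ≤ t ∧ t ≤ j ∧ f t = x) ∨ x ∈ R ∨ x = f i} with hH
  have hft : ∀ t, k + 1 ≤ t → t ≤ j → f t ∈ H := fun t h1 h2 => Or.inl ⟨t, h1, h2, rfl⟩
  have hRH : R ⊆ H := fun x hx => Or.inr (Or.inl hx)
  have hiH : f i ∈ H := Or.inr (Or.inr rfl)
  obtain ⟨r, hr, er⟩ := C.hi
  obtain ⟨s, hs, es⟩ := C.hj
  have c1 : ∀ t, k + 1 ≤ t → t ≤ j → RC G H (f (k + 1)) (f t) := fun t h1 h2 =>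
    B.RC_sg h1 (fun t' h3 h4 => hft t' h3 (by omega))
  have c2 : ∀ x ∈ R, RC G H (f (k + 1)) x := fun x hx =>
    ((c1 j (by omega) le_rfl).trans (RC.edge (hft j (by omega) le_rfl) (hRH hs) es.symm)).trans
      ((B.conn s hs x hx).mono hRH)
  have hc : ∀ x ∈ H, RC G H (f (k + 1)) x := by
    rintro x (⟨t, h1, h2, rfl⟩ | hx | rfl)
    · exact c1 t h1 h2
    · exact c2 x hx
    · exact (c2 r hr).trans (RC.edge (hRH hr) hiH er)
  rcases adh3 B.adh (hft (k + 1) le_rfl (by omega)) hc hiH (B.cyc.adj k) hk3.symm with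
    h | h | ⟨p, hp, h1, h2⟩ | ⟨p, hp, q, hq, h1, h2, h3⟩
  · exact B.inj i (k + 1) (by omega) (by omega) h.symm
  · exact hnb (k + 1) (by omega) (by omega) h.symm
  · rcases hp with ⟨t, ht1, ht2, rfl⟩ | hp | rfl
    · exact hnb t (by omega) ht2 h2.symm
    · exact C.gap (k + 1) (by omega) hk4 ⟨p, hp, h1.symm⟩
    · exact h2.ne rfl
  · rcases hq with ⟨t, ht1, ht2, rfl⟩ | hq | rfl
    · exact hnb t (by omega) ht2 h3.symm
    · rcases hp with ⟨t, ht1, ht2, rfl⟩ | hp | rfl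
      · rcases eq_or_lt_of_le ht2 with h4 | h4
        · subst h4; exact hcr h1
        · exact C.gap t (by omega) h4 ⟨q, hq, h2.symm⟩
      · exact C.gap (k + 1) (by omega) hk4 ⟨p, hp, h1.symm⟩
      · exact hnb (k + 1) (by omega) (by omega) h1.symm
    · exact h3.ne rfl

lemma Conf.uv2 {i j : ℤ} (C : Conf G m f R i j) {u : V} (hu : u ∈ R) (hu1 : G.Adj u (f i)) :
    G.Adj u (f j) := by
  have B := C.big
  have a1 := C.hj1
  have a2 := C.hj2
  have hij := C.hij
  set H : Set V := {x | (∃ t, i + 1 ≤ t ∧ t ≤ j ∧ f t = x) ∨ x ∈ R} with hH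
  have hft : ∀ t, i + 1 ≤ t → t ≤ j → f t ∈ H := fun t h1 h2 => Or.inl ⟨t, h1, h2, rfl⟩
  have hRH : R ⊆ H := fun x hx => Or.inr hx
  obtain ⟨s, hs, es⟩ := C.hj
  have c2 : ∀ x ∈ R, RC G H u x := fun x hx => (B.conn u hu x hx).mono hRH
  have hc : ∀ x ∈ H, RC G H u x := by
    rintro x (⟨t, h1, h2, rfl⟩ | hx)
    · refine ((c2 s hs).trans (RC.edge (hRH hs) (hft j (by omega) le_rfl) es)).trans ?_
      exact (B.RC_sg h2 (fun t' h3 h4 => hft t' (by omega) h4)).symm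
    · exact c2 x hx
  have hnat : ∀ t, i + 1 ≤ t → t ≤ j → At G R (f t) → t = j := by
    intro t h1 h2 h3
    by_contra hne
    exact C.gap t (by omega) (by omega) h3
  have hj1 : ¬ G.Adj (f j) (f (i + 1)) := fun e =>
    B.ps' C.hi C.hj C.ne (le_KG G e.symm)
  rcases adh3 B.adh (hRH hu) hc (hft (i + 1) le_rfl (by omega)) hu1.symm (B.cyc.adj i) with
    h | h | ⟨p, hp, h1, h2⟩ | ⟨p, hp, q, hq, h1, h2, h3⟩
  · exact absurd h.symm (B.out u hu _)
  · exact absurd (le_KG G h) (B.not_succ C.hi hu)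
  · rcases hp with ⟨t, ht1, ht2, rfl⟩ | hp
    · have := hnat t ht1 ht2 ⟨u, hu, h1⟩
      subst this
      exact h1
    · exact absurd (le_KG G h2) (B.not_succ C.hi hp)
  · rcases hq with ⟨t, ht1, ht2, rfl⟩ | hq
    · rcases hp with ⟨t', ht1', ht2', rfl⟩ | hp
      · have := hnat t' ht1' ht2' ⟨u, hu, h1⟩
        subst this
        exact h1
      · have := hnat t ht1 ht2 ⟨p, hp, h2⟩
        subst this
        exact absurd h3 hj1
    · exact absurd (le_KG G h3) (B.not_succ C.hi hq)

end big2

section big3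

variable {V : Type*} [Fintype V] {G : SimpleGraph V} {m : ℕ} {f : ℤ → V} {R : Set V}

lemma Big.lemU (B : Big G m f R) {k : ℤ} (hk : ¬ At G R (f k))
    (hpm : (KG G).Adj (f (k - 1)) (f (k + 1))) {u : V} (hu : u ∈ R) (h1 : Heavy G u)
    (h2 : Heavy G (f k)) : False := by
  classical
  have hux : (KG G).Adj u (f k) := ⟨(B.out u hu k).symm, Or.inr ⟨h1, h2⟩⟩
  obtain ⟨φ, hφ, hφ1, -⟩ := B.cyc.pred 1
  set T : Set V := G.neighborSet u ∩ Set.range f with hT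
  set N : Set V := G.neighborSet u ∪ G.neighborSet (f k) with hN
  have hsub : G.neighborSet u ∩ G.neighborSet (f k) ⊆ T := by
    rintro z ⟨z1, z2⟩
    refine ⟨z1, ?_⟩
    by_contra hz
    have hz' : ∀ a, f a ≠ z := fun a ha => hz ⟨a, ha⟩
    exact hk ⟨z, B.cl u hu z z1 hz', G.symm.symm _ _ z2⟩
  have huN : u ∉ N := by
    rintro (h | h)
    · exact G.loopless.irrefl _ h
    · exact hk ⟨u, hu, G.symm.symm _ _ h⟩
  have hdis : Disjoint (φ '' T) (insert u N) := by
    rw [Set.disjoint_left]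
    rintro _ ⟨_, ⟨hz, ⟨a, rfl⟩⟩, rfl⟩
    rw [hφ1]
    have hat : At G R (f a) := ⟨u, hu, hz⟩
    rintro (h | h | h)
    · exact B.out u hu _ h
    · exact B.not_succ hat hu (le_KG G h)
    · rw [mem_neighborSet] at h hz
      have hne : f a ≠ f k := by
        intro e
        rw [e] at hat
        exact hk hat
      obtain ⟨k', b1, b2, b3, b4, b5⟩ := B.norm hne
      rw [← b3] at h hux
      rw [← b4, ← b5] at hpm
      have b6 : k' ≠ a + 1 := by
        rintro rfl
        exact h.ne rfl
      have p := ((B.sp (le_refl k')).append (le_KG G h)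
        (B.sp (i := a + 1) (j := k' - 1) (by omega))).append hpm
        (B.sp (i := k' + 1) (j := a + m) (by omega))
      refine B.no_path hu hu hux (by rw [B.cyc.per]; exact le_KG G hz) p ?_ ?_ ?_
      · simp only [List.nodup_append', List.disjoint_append_left]
        exact ⟨⟨sg_nodup B.inj (by omega), sg_nodup B.inj (by omega),
          sg_disj' B.inj (by omega) (by omega)⟩, sg_nodup B.inj (by omega),
          sg_disj B.inj (by omega) (by omega), sg_disj B.inj (by omega) (by omega)⟩
      · simp only [List.mem_append, mem_sg]
        grind
      · simp; omega
  have c1 := Set.ncard_union_eq hdis (Set.toFinite _) (Set.toFinite _)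
  rw [Set.ncard_image_of_injective _ hφ, Set.ncard_insert_of_notMem huN (Set.toFinite _)] at c1
  have c2 := Set.ncard_le_card (φ '' T ∪ insert u N)
  rw [Nat.card_eq_fintype_card] at c2
  have c3 := Set.ncard_union_add_ncard_inter (G.neighborSet u) (G.neighborSet (f k))
    (Set.toFinite _) (Set.toFinite _)
  have c4 := Set.ncard_le_ncard hsub (Set.toFinite _)
  unfold Heavy at h1 h2
  rw [← hN] at c3
  omega

lemma Conf.lemB {i j k : ℤ} (C : Conf G m f R i j) (hk1 : j < k) (hk2 : k < i + m)
    (hk : ¬ At G R (f k)) (e1 : G.Adj (f i) (f k)) : ¬ (KG G).Adj (f k) (f j) := by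
  intro e2
  have B := C.big
  have a1 := C.hj1
  have a2 := C.hj2
  have hij := C.hij
  obtain ⟨u, hu, eu⟩ := C.hi
  have er := le_KG G eu
  obtain ⟨s, hs, es⟩ := C.hj.K
  have hpj := B.pm C.hj
  have hpi := B.pm C.hi
  have hk3 : k ≠ i + m - 1 := by
    rintro rfl
    rw [show i + (m : ℤ) - 1 = i - 1 + m by ring, B.cyc.per] at e2
    exact B.ms' C.hi C.hj C.ne e2
  have hk4 : k ≠ j + 1 := by
    rintro rfl
    exact B.ps' C.hj C.hi C.ne.symm (le_KG G e1.symm)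
  rw [← B.cyc.per, show i - 1 + (m : ℤ) = i + m - 1 by ring] at hpi
  have n1 : ¬ (KG G).Adj (f (k + 1)) (f i) := by
    intro e
    have p := ((((B.sp (le_refl i)).append e.symm
      (B.sp (i := k + 1) (j := i + m - 1) (by omega))).append hpi
      (B.sp (i := i + 1) (j := j - 1) (by omega))).append hpj
      (B.sp (i := j + 1) (j := k) (by omega))).append e2 (B.sp (le_refl j))
    refine B.no_path hu hs er es p ?_ ?_ ?_
    · simp only [List.nodup_append', List.disjoint_append_left]
      refine ⟨⟨⟨⟨?_, ?_, ?_⟩, ?_, ?_, ?_⟩, ?_, ⟨?_, ?_⟩, ?_⟩, ?_, ⟨⟨?_, ?_⟩, ?_⟩, ?_⟩ <;>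
      first
      | exact sg_nodup B.inj (by omega)
      | exact sg_disj B.inj (by omega) (by omega)
      | exact sg_disj' B.inj (by omega) (by omega)
    · simp only [List.mem_append, mem_sg]
      grind
    · simp; omega
  have n2 : ¬ (KG G).Adj (f (k - 1)) (f i) := by
    intro e
    have p := ((((B.sp (le_refl j)).append e2.symm
      (B.sp (i := k) (j := i + m - 1) (by omega))).append hpi
      (B.sp (i := i + 1) (j := j - 1) (by omega))).append hpj
      (B.sp (i := j + 1) (j := k - 1) (by omega))).append e (B.sp (le_refl i))
    refine B.no_path hs hu es er p ?_ ?_ ?_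
    · simp only [List.nodup_append', List.disjoint_append_left]
      refine ⟨⟨⟨⟨?_, ?_, ?_⟩, ?_, ?_, ?_⟩, ?_, ⟨?_, ?_⟩, ?_⟩, ?_, ⟨⟨?_, ?_⟩, ?_⟩, ?_⟩ <;>
      first
      | exact sg_nodup B.inj (by omega)
      | exact sg_disj B.inj (by omega) (by omega)
      | exact sg_disj' B.inj (by omega) (by omega)
    · simp only [List.mem_append, mem_sg]
      grind
    · simp; omega
  have hm := B.hm
  have hpk : (KG G).Adj (f (k - 1)) (f (k + 1)) := by
    rcases KG_claw B.tw (B.adjp k) (B.cyc.adj k) e1.symm (B.inj _ _ (by omega) (by omega))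
      (B.inj i (k - 1) (by omega) (by omega)).symm
      (B.inj i (k + 1) (by omega) (by omega)).symm with h | h | h
    · exact h
    · exact absurd h n2
    · exact absurd h n1
  have huk : ¬ (KG G).Adj u (f k) := by
    rintro ⟨_, h | ⟨h, h'⟩⟩
    · exact hk ⟨u, hu, h⟩
    · exact B.lemU hk hpk hu h h'
  have hka : (KG G).Adj (f k) (f (i + 1)) := by
    rcases KG_claw B.tw eu.symm e1 (B.cyc.adj i) (B.out u hu _).symm (B.out u hu _).symm
      (B.inj (i + 1) k (by omega) (by omega)).symm with h | h | h
    · exact absurd h huk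
    · exact absurd h (B.not_succ C.hi hu)
    · exact h
  have p := ((((B.sp (le_refl j)).append e2.symm (B.sp (le_refl k))).append hka
    (B.sp (i := i + 1) (j := j - 1) (by omega))).append hpj
    (B.sp (i := j + 1) (j := k - 1) (by omega))).append hpk
    (B.sp (i := k + 1) (j := i + m) (by omega))
  refine B.no_path hs hu es (by rw [B.cyc.per]; exact er) p ?_ ?_ ?_
  · simp only [List.nodup_append', List.disjoint_append_left]
    refine ⟨⟨⟨⟨?_, ?_, ?_⟩, ?_, ?_, ?_⟩, ?_, ⟨?_, ?_⟩, ?_⟩, ?_, ⟨⟨?_, ?_⟩, ?_⟩, ?_⟩ <;>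
    first
    | exact sg_nodup B.inj (by omega)
    | exact sg_disj B.inj (by omega) (by omega)
    | exact sg_disj' B.inj (by omega) (by omega)
  · simp only [List.mem_append, mem_sg]
    grind
  · simp; omega

lemma Conf.exists_w {i j : ℤ} (C : Conf G m f R i j) : ∃ k, j < k ∧ k < i + m ∧
    ¬ At G R (f k) ∧ G.Adj (f i) (f k) ∧ G.Adj (f k) (f (j - 1)) := by
  have B := C.big
  have a1 := C.hj1
  have a2 := C.hj2
  have hij := C.hij
  obtain ⟨u, hu, eu⟩ := C.hi
  have euj := C.uv2 hu eu
  set H : Set V := {x | x = u ∨ x = f i ∨ x = f (j - 1) ∨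
    ∃ t, j < t ∧ t < i + m ∧ ¬ At G R (f t) ∧ f t = x} with hH
  have hft : ∀ t, j < t → t < i + m → ¬ At G R (f t) → f t ∈ H :=
    fun t h1 h2 h3 => Or.inr (Or.inr (Or.inr ⟨t, h1, h2, h3, rfl⟩))
  have huH : u ∈ H := Or.inl rfl
  have hiH : f i ∈ H := Or.inr (Or.inl rfl)
  have hbH : f (j - 1) ∈ H := Or.inr (Or.inr (Or.inl rfl))
  have hn1 : ¬ At G R (f (j + 1)) := B.succ_notAt C.hj
  have hn2 : ¬ At G R (f (i + m - 1)) := by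
    rw [show i + (m : ℤ) - 1 = i - 1 + m by ring, B.cyc.per]
    exact B.pred_notAt C.hi
  have hb : ¬ At G R (f (j - 1)) := C.gap _ (by omega) (by omega)
  have key : ∀ n : ℕ, ∀ t, t = j + 1 + (n : ℤ) → t < i + m → ¬ At G R (f t) →
      RC G H (f (j + 1)) (f t) := by
    intro n
    induction n using Nat.strong_induction_on with
    | _ n ih =>
      intro t ht1 ht2 ht3
      rcases Nat.eq_zero_or_pos n with h0 | h0
      · subst h0
        rw [ht1]
        simp only [Nat.cast_zero, add_zero]
        exact Relation.ReflTransGen.refl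
      · by_cases hp : At G R (f (t - 1))
        · have hn : n ≠ 1 := by
            rintro rfl
            rw [show t - 1 = j + 1 by omega] at hp
            exact hn1 hp
          have hq := B.pred_notAt hp
          have e := C.unb (t - 1) hp (B.inj i (t - 1) (by omega) (by omega)).symm
          rw [show t - 1 + 1 = t by ring] at e
          exact (ih (n - 2) (by omega) (t - 1 - 1) (by omega) (by omega) hq).trans
            (RC.edge (hft _ (by omega) (by omega) hq) (hft _ (by omega) ht2 ht3) e)
        · exact (ih (n - 1) (by omega) (t - 1) (by omega) (by omega) hp).trans
            (RC.edge (hft _ (by omega) (by omega) hp) (hft _ (by omega) ht2 ht3)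
              (B.adjp t).symm)
  have key2 : ∀ t, j < t → t < i + m → ¬ At G R (f t) → RC G H (f (j + 1)) (f t) :=
    fun t h1 h2 h3 => key (t - j - 1).toNat t (by omega) h2 h3
  have c1 : RC G H u (f i) := RC.edge huH hiH eu
  have c2 : RC G H u (f (j + 1)) := by
    refine (c1.trans (RC.edge hiH (hft (i + m - 1) (by omega) (by omega) hn2) ?_)).trans
      (key2 _ (by omega) (by omega) hn2).symm
    rw [show i + (m : ℤ) - 1 = i - 1 + m by ring, B.cyc.per]
    exact B.adjp i
  have hc : ∀ x ∈ H, RC G H u x := by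
    rintro x (rfl | rfl | rfl | ⟨t, h1, h2, h3, rfl⟩)
    · exact Relation.ReflTransGen.refl
    · exact c1
    · exact c2.trans (RC.edge (hft _ (by omega) (by omega) hn1) hbH
        (C.unb j C.hj C.ne.symm).symm)
    · exact c2.trans (key2 t h1 h2 h3)
  have hv1b : ¬ G.Adj (f i) (f (j - 1)) := fun e =>
    B.ms' C.hj C.hi C.ne.symm (le_KG G e.symm)
  rcases adh3 B.adh huH hc hbH euj.symm (B.adjp j) with
    h | h | ⟨p, hp, h1, h2⟩ | ⟨p, hp, q, hq, h1, h2, h3⟩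
  · exact absurd h.symm (B.out u hu _)
  · exact absurd ⟨u, hu, h⟩ hb
  · exfalso
    rcases hp with rfl | rfl | rfl | ⟨t, _, _, ht, rfl⟩
    · exact h1.ne rfl
    · exact hv1b h2
    · exact h2.ne rfl
    · exact ht ⟨u, hu, h1⟩
  · have hp' : p = f i := by
      rcases hp with rfl | rfl | rfl | ⟨t, _, _, ht, rfl⟩
      · exact absurd rfl h1.ne
      · rfl
      · exact absurd ⟨u, hu, h1⟩ hb
      · exact absurd ⟨u, hu, h1⟩ ht
    subst hp'
    rcases hq with rfl | rfl | rfl | ⟨t, h4, h5, h6, rfl⟩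
    · exact absurd ⟨q, hu, h3⟩ hb
    · exact absurd rfl h2.ne
    · exact absurd rfl h3.ne
    · exact ⟨t, h4, h5, h6, h2, h3⟩

lemma Conf.absurd {i j : ℤ} (C : Conf G m f R i j) : False := by
  have B := C.big
  have a1 := C.hj1
  have a2 := C.hj2
  have hij := C.hij
  obtain ⟨r, hr, er⟩ := C.hi.K
  obtain ⟨s, hs, es⟩ := C.hj.K
  obtain ⟨k, hk1, hk2, hk, e1, e2⟩ := C.exists_w
  have n1 := C.lemB hk1 hk2 hk e1
  have e3 : (KG G).Adj (f k) (f (i + 1)) := by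
    rcases KG_claw B.tw e1 (B.cyc.adj i) C.v1v2 (B.inj (i + 1) k (by omega) (by omega)).symm
      (B.inj j k (by omega) (by omega)).symm (B.inj (i + 1) j (by omega) (by omega)) with h | h | h
    · exact h
    · exact (n1 h).elim
    · exact (B.ps' C.hi C.hj C.ne h).elim
  have hk3 : k ≠ i + m - 1 := by
    rintro rfl
    rw [show i + (m : ℤ) - 1 = i - 1 + m by ring, B.cyc.per] at e2
    exact B.mm' C.hi C.hj C.ne (le_KG G e2)
  rcases KG_claw B.tw e1.symm e2 (B.cyc.adj k) (B.inj i (j - 1) (by omega) (by omega))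
    (B.inj i (k + 1) (by omega) (by omega)) (B.inj (j - 1) (k + 1) (by omega) (by omega))
    with h | h | h
  · exact B.ms' C.hj C.hi C.ne.symm h.symm
  · have hpi := B.pm C.hi
    rw [← B.cyc.per, show i - 1 + (m : ℤ) = i + m - 1 by ring] at hpi
    have p := (((B.sp (i := j) (j := k) (by omega)).append (le_KG G e2)
      (B.sp (i := i + 1) (j := j - 1) (by omega)).reverse).append hpi.symm
      (B.sp (i := k + 1) (j := i + m - 1) (by omega)).reverse).append h.symm (B.sp (le_refl i))
    refine B.no_path hs hr es er p ?_ ?_ ?_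
    · simp only [List.nodup_append', List.disjoint_append_left, List.nodup_reverse,
        List.disjoint_reverse_left, List.disjoint_reverse_right]
      refine ⟨⟨⟨?_, ?_, ?_⟩, ?_, ?_, ?_⟩, ?_, ⟨?_, ?_⟩, ?_⟩ <;>
      first
      | exact sg_nodup B.inj (by omega)
      | exact sg_disj B.inj (by omega) (by omega)
      | exact sg_disj' B.inj (by omega) (by omega)
    · simp only [List.mem_append, List.mem_reverse, mem_sg]
      grind
    · simp; omega
  · have p := ((B.sp (i := j) (j := k) (by omega)).append e3
      (B.sp (i := i + 1) (j := j - 1) (by omega))).append h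
      (B.sp (i := k + 1) (j := i + m) (by omega))
    refine B.no_path hs hr es (by rw [B.cyc.per]; exact er) p ?_ ?_ ?_
    · simp only [List.nodup_append', List.disjoint_append_left]
      refine ⟨⟨?_, ?_, ?_⟩, ?_, ?_, ?_⟩ <;>
      first
      | exact sg_nodup B.inj (by omega)
      | exact sg_disj B.inj (by omega) (by omega)
      | exact sg_disj' B.inj (by omega) (by omega)
    · simp only [List.mem_append, mem_sg]
      grind
    · simp; omega

end big3

theorem hamiltonian_of_twoHeavy_adh {V : Type*} [Fintype V] [DecidableEq V] (G : SimpleGraph V)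
    (h3 : 3 ≤ Fintype.card V) (h2conn : ∀ v : V, (G.induce {v}ᶜ).Connected)
    (h2h : TwoHeavy G) (hadh : AlmostDH G) : G.IsHamiltonian := by
  obtain ⟨m0, f0, h0⟩ := exists_cyc G h3 h2conn
  obtain ⟨m, f, hc, hmax⟩ := exists_max_cyc h0
  by_cases hcov : ∀ v, ∃ k, f k = v
  · exact ham_of_cover hc hcov
  exfalso
  push Not at hcov
  obtain ⟨u, hu⟩ := hcov
  set D : Set V := {x | ∀ k, f k ≠ x} with hD
  set R : Set V := {x | RC G D u x} with hR
  have hRD : ∀ r ∈ R, r ∈ D := fun r hr => (RC.reachable (G := G) (H := D) (x := u) (y := r) hu hr).1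
  have huR : ∀ r ∈ R, RC G R u r := by
    intro r hr
    have hr' : RC G D u r := hr
    clear hr
    induction hr' with
    | refl => exact Relation.ReflTransGen.refl
    | tail h1 h2 ih =>
      exact ih.trans (RC.edge h1 (Relation.ReflTransGen.tail h1 h2) h2.2.2)
  have hcl : ∀ r ∈ R, ∀ s, G.Adj r s → (∀ k, f k ≠ s) → s ∈ R := by
    intro r hr s e hs
    exact RC.trans hr (RC.edge (hRD r hr) hs e)
  have B : Big G m f R := by
    refine ⟨hc, hmax, h2h, hadh, hRD, fun r hr s hs => (huR r hr).symm.trans (huR s hs),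
      hcl, ?_⟩
    intro i
    by_contra hcon
    push Not at hcon
    have hm := hc.hm
    have hne : f (i + 1) ≠ f i := (hc.inj i (i + 1) (by omega) (by omega)).symm
    have hr : RC G {f i}ᶜ u (f (i + 1)) :=
      RC.of_reachable (x := ⟨u, (hu i).symm⟩) (y := ⟨f (i + 1), hne⟩)
        ((h2conn (f i)).preconnected _ _)
    have hin : ∀ x, RC G {f i}ᶜ u x → x ∈ R := by
      intro x hx
      induction hx with
      | refl => exact Relation.ReflTransGen.refl
      | tail _ h ih =>
        obtain ⟨_, h2, h3⟩ := h
        refine hcl _ ih _ h3 ?_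
        rintro k rfl
        exact hcon k h2 _ ih h3
    exact hRD _ (hin _ hr) (i + 1) rfl
  obtain ⟨i, j, C⟩ := B.conf
  exact C.absurd
end
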